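/- Under the (f,Γ)-GAN assumptions (see context), if in addition inf_{θ∈Θ} D_f^{Γ̃}(μ_n‖P_θ) = 0 for all possible empirical distributions μ_n, then for every ε > 0: ℙ( D_f^Γ(Q‖P_{θ*_{n,m}}) ≥ ε + ε_{approx}^{Γ,Γ̃} + ε^{opt}_{n,m} + 2 R_{Γ̃,Q,n} + 4 K_{f,Γ̃∘Φ,P_Z,m} ) ≤ exp( −ε² / ( (1/(2n))(β−α)² + (2/m) Δ_{f,m}² ) ). -/

import Mathlib

open MeasureTheory Set Filter Topology
open scoped ENNReal NNReal Classical

noncomputable section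

/-- The interval `(a, b)` with `b` possibly infinite. -/
def Dom (a : ℝ) (b : EReal) : Set ℝ := {t : ℝ | a < t ∧ (t : EReal) < b}

/-- Legendre transform of `f` on `(a,b)`, with values in `(-∞, ∞]` (modeled by `EReal`). -/
def fStar (f : ℝ → ℝ) (a : ℝ) (b : EReal) (z : ℝ) : EReal :=
  ⨆ t ∈ Dom a b, ((z * t - f t : ℝ) : EReal)

/-- Real-valued version of the Legendre transform (junk value where it is `⊤`). -/
def fStarR (f : ℝ → ℝ) (a : ℝ) (b : EReal) (z : ℝ) : ℝ := (fStar f a b z).toReal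

/-- Right derivative of `g` at `z`. -/
def rderiv (g : ℝ → ℝ) (z : ℝ) : ℝ := derivWithin g (Ici z) z

/-- `z₀ := f'_+(1)`. -/
def zz (f : ℝ → ℝ) : ℝ := rderiv f 1

/-- Integral of an `EReal`-valued function: the Bochner integral if the function is
a.e. finite and integrable, and `⊤` otherwise. -/
def eIntegral {X : Type*} [MeasurableSpace X] (P : Measure X) (g : X → EReal) : EReal :=
  if (∀ᵐ x ∂P, g x ≠ ⊤) ∧ Integrable (fun x => (g x).toReal) P
  then ((∫ x, (g x).toReal ∂P : ℝ) : EReal) else ⊤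

/-- The generalized cumulant generating function `Λ_f^P[h]`. -/
def cgf {X : Type*} [MeasurableSpace X] (f : ℝ → ℝ) (a : ℝ) (b : EReal)
    (P : Measure X) (h : X → ℝ) : EReal :=
  ⨅ ν : ℝ, ((ν : EReal) + eIntegral P (fun x => fStar f a b (h x - ν)))

/-- Real-valued `Λ_f^P[h]`. -/
def cgfR {X : Type*} [MeasurableSpace X] (f : ℝ → ℝ) (a : ℝ) (b : EReal)
    (P : Measure X) (h : X → ℝ) : ℝ := (cgf f a b P h).toReal

/-- `Λ_f : ℝⁿ → ℝ` (with values in `EReal`). -/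
def lamVec (f : ℝ → ℝ) (a : ℝ) (b : EReal) {n : ℕ} (x : Fin n → ℝ) : EReal :=
  ⨅ ν : ℝ, ((ν : EReal) + ((n : ℝ)⁻¹ : EReal) * ∑ i, fStar f a b (x i - ν))

/-- Empirical measure of `n` points. -/
def empMeas {X : Type*} [MeasurableSpace X] (n : ℕ) (xs : Fin n → X) : Measure X :=
  (n : ℝ≥0∞)⁻¹ • ∑ i, Measure.dirac (xs i)

/-- The `(f,Γ)`-divergence `D_f^Γ(Q‖P)`. -/
def Dfg {X : Type*} [MeasurableSpace X] (f : ℝ → ℝ) (a : ℝ) (b : EReal)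
    (Γ : Set (X → ℝ)) (Q P : Measure X) : ℝ :=
  sSup {r : ℝ | ∃ h ∈ Γ, r = ∫ x, h x ∂Q - cgfR f a b P h}

/-- Empirical Rademacher complexity of `Ψ` at the sample `y`. -/
def empRad {Y : Type*} (Ψ : Set (Y → ℝ)) (n : ℕ) (y : Fin n → Y) : ℝ :=
  (2 ^ n : ℝ)⁻¹ * ∑ σ : Fin n → Bool,
    sSup {r : ℝ | ∃ ψ ∈ Ψ, r = (n : ℝ)⁻¹ * ∑ i, (if σ i then 1 else -1) * ψ (y i)}

/-- Rademacher complexity of `Ψ` relative to `P` with `n` samples. -/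
def rad {Y : Type*} [MeasurableSpace Y] (Ψ : Set (Y → ℝ)) (P : Measure Y) (n : ℕ) : ℝ :=
  ∫ y, empRad Ψ n y ∂(Measure.pi fun _ : Fin n => P)

/-- `Δ_{f,n}`. -/
def Δq (f : ℝ → ℝ) (a : ℝ) (b : EReal) (α β : ℝ) (n : ℕ) : ℝ :=
  sInf ((fun z => (n : ℝ) * (-z + (((n : ℝ) - 1) / (n : ℝ)) * fStarR f a b z
      + (1 / (n : ℝ)) * fStarR f a b (β - α + z))) '' Icc (zz f - (β - α)) (zz f))

/-- `sup_{h ∈ Γ} inf_{h̃ ∈ Γ̃} ‖h − h̃‖_∞`. -/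
def approxErr {X : Type*} (Γ Γt : Set (X → ℝ)) : ℝ :=
  sSup {r : ℝ | ∃ h ∈ Γ, r = sInf {s : ℝ | ∃ ht ∈ Γt, s = ⨆ x, |h x - ht x|}}

/-- A countable subset which is pointwise-limit dense. -/
def PtwiseDenseCount {X : Type*} (Γ : Set (X → ℝ)) : Prop :=
  ∃ Γ₀ ⊆ Γ, Γ₀.Countable ∧ ∀ h ∈ Γ, ∃ s : ℕ → X → ℝ,
    (∀ j, s j ∈ Γ₀) ∧ ∀ x, Tendsto (fun j => s j x) atTop (𝓝 (h x))

/-- The quantity `K_{f,Ψ,P,n}` from Definition 3.4: either `(f*)'_+` is Lipschitz on the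
relevant interval and `Ψ` contains a constant, in which case `K` is the minimum of the two
expressions, or `K` is the second expression. -/
def Kchoice (f : ℝ → ℝ) (a : ℝ) (b : EReal) (α β : ℝ) {Y : Type*} [MeasurableSpace Y]
    (Ψ : Set (Y → ℝ)) (P : Measure Y) (n : ℕ) (K : ℝ) : Prop :=
  (∃ L : ℝ≥0, LipschitzOnWith L (rderiv (fStarR f a b))
      (Icc (zz f - (β - α)) (zz f + (β - α))) ∧
    (∃ c : ℝ, (fun _ => c) ∈ Ψ) ∧
    K = min ((1 + 2 * (β - α) * (L : ℝ)) * rad Ψ P n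
        + (β - α) ^ 2 * (L : ℝ) / (2 * Real.sqrt n))
      (rderiv (fStarR f a b) (β - α + zz f) * (rad Ψ P n + (β - α) / (2 * Real.sqrt n))))
  ∨ K = rderiv (fStarR f a b) (β - α + zz f) * (rad Ψ P n + (β - α) / (2 * Real.sqrt n))

/-- Covering number of a (pseudo)metric space by `ε`-balls. -/
def coverNum (Θ : Type*) [PseudoMetricSpace Θ] (ε : ℝ) : ℝ≥0∞ :=
  ⨅ s ∈ {s : Finset Θ | ∀ θ : Θ, ∃ c ∈ s, dist θ c ≤ ε}, ((s.card : ℝ≥0∞))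

end

/-! ### The Legendre transform -/

section Legendre

variable {f : ℝ → ℝ} {a : ℝ} {b : EReal}

lemma isOpen_Dom (a : ℝ) (b : EReal) : IsOpen (Dom a b) :=
  (isOpen_lt continuous_const continuous_id).inter
    (isOpen_lt continuous_coe_real_ereal continuous_const)

lemma rderiv_eq_Ioi (g : ℝ → ℝ) (z : ℝ) : rderiv g z = derivWithin g (Ioi z) z :=
  (derivWithin_Ioi_eq_Ici g z).symm

lemma ConvexOn.add_rderiv_mul_le {S : Set ℝ} {g : ℝ → ℝ} (hg : ConvexOn ℝ S g) {x y : ℝ}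
    (hx : x ∈ interior S) (hy : y ∈ S) : g x + rderiv g x * (y - x) ≤ g y := by
  rw [rderiv_eq_Ioi]
  rcases lt_trichotomy x y with h | h | h
  · have h1 := hg.rightDeriv_le_slope_of_mem_interior hx hy h
    rw [slope_def_field, le_div_iff₀ (by linarith)] at h1
    linarith
  · simp [h]
  · have h1 := (hg.slope_le_leftDeriv_of_mem_interior hy hx h).trans
      (hg.leftDeriv_le_rightDeriv_of_mem_interior hx)
    rw [slope_def_field, div_le_iff₀ (by linarith)] at h1
    nlinarith

lemma le_fStar {t : ℝ} (ht : t ∈ Dom a b) (z : ℝ) :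
    ((z * t - f t : ℝ) : EReal) ≤ fStar f a b z :=
  le_iSup₂_of_le t ht le_rfl

lemma fStar_le_coe {z c : ℝ} (h : ∀ t ∈ Dom a b, z * t - f t ≤ c) :
    fStar f a b z ≤ (c : EReal) :=
  iSup₂_le fun t ht => by exact_mod_cast h t ht

lemma monotone_fStar (ha0 : 0 ≤ a) : Monotone (fStar f a b) := by
  intro z z' hz
  refine iSup₂_le fun t ht => le_trans ?_ (le_fStar ht z')
  have : 0 ≤ t := ha0.trans ht.1.le
  exact_mod_cast sub_le_sub_right (mul_le_mul_of_nonneg_right hz this) _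

variable (ha1 : a < 1) (hb1 : ((1 : ℝ) : EReal) < b) (hf1 : f 1 = 0)
include ha1 hb1 hf1

lemma self_le_fStar (z : ℝ) : (z : EReal) ≤ fStar f a b z := by
  simpa [hf1] using le_fStar (f := f) (show (1 : ℝ) ∈ Dom a b from ⟨ha1, hb1⟩) z

lemma fStar_ne_bot (z : ℝ) : fStar f a b z ≠ ⊥ := fun h => by
  have := self_le_fStar ha1 hb1 hf1 z
  simp [h] at this

lemma coe_fStarR {z : ℝ} (hz : fStar f a b z < ⊤) : (fStarR f a b z : EReal) = fStar f a b z :=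
  EReal.coe_toReal hz.ne (fStar_ne_bot ha1 hb1 hf1 z)

lemma self_le_fStarR {z : ℝ} (hz : fStar f a b z < ⊤) : z ≤ fStarR f a b z := by
  have := self_le_fStar ha1 hb1 hf1 z
  rw [← coe_fStarR ha1 hb1 hf1 hz] at this
  exact_mod_cast this

lemma sub_le_fStarR {t z : ℝ} (ht : t ∈ Dom a b) (hz : fStar f a b z < ⊤) :
    z * t - f t ≤ fStarR f a b z := by
  have := le_fStar (f := f) ht z
  rw [← coe_fStarR ha1 hb1 hf1 hz] at this
  exact_mod_cast this

lemma fStarR_le {z c : ℝ} (h : ∀ t ∈ Dom a b, z * t - f t ≤ c) : fStarR f a b z ≤ c := by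
  have h1 := fStar_le_coe h
  rw [← coe_fStarR ha1 hb1 hf1 (h1.trans_lt (EReal.coe_lt_top c))] at h1
  exact_mod_cast h1

lemma convexOn_fStarR : ConvexOn ℝ {z | fStar f a b z < ⊤} (fStarR f a b) := by
  have key : ∀ x, fStar f a b x < ⊤ → ∀ y, fStar f a b y < ⊤ → ∀ p q : ℝ, 0 ≤ p → 0 ≤ q →
      p + q = 1 → ∀ t ∈ Dom a b,
      (p * x + q * y) * t - f t ≤ p * fStarR f a b x + q * fStarR f a b y := by
    intro x hx y hy p q hp hq hpq t ht
    have h1 := mul_le_mul_of_nonneg_left (sub_le_fStarR ha1 hb1 hf1 ht hx) hp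
    have h2 := mul_le_mul_of_nonneg_left (sub_le_fStarR ha1 hb1 hf1 ht hy) hq
    have h3 : f t = p * f t + q * f t := by rw [← add_mul, hpq, one_mul]
    linarith
  refine ⟨fun x hx y hy p q hp hq hpq => ?_, fun x hx y hy p q hp hq hpq => ?_⟩
  · exact (fStar_le_coe (key x hx y hy p q hp hq hpq)).trans_lt (EReal.coe_lt_top _)
  · exact fStarR_le ha1 hb1 hf1 (key x hx y hy p q hp hq hpq)

variable (hconv : ConvexOn ℝ (Dom a b) f)
include hconv

lemma fStar_zz : fStar f a b (zz f) = (zz f : EReal) := by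
  refine le_antisymm (fStar_le_coe fun t ht => ?_) (self_le_fStar ha1 hb1 hf1 _)
  have h1 : (1 : ℝ) ∈ interior (Dom a b) := by
    rw [(isOpen_Dom a b).interior_eq]; exact ⟨ha1, hb1⟩
  have := hconv.add_rderiv_mul_le h1 ht
  rw [hf1] at this
  unfold zz
  linarith

lemma fStarR_zz : fStarR f a b (zz f) = zz f := by
  simp [fStarR, fStar_zz ha1 hb1 hf1 hconv]

lemma rderiv_fStarR_zz
    (hstrict : ∃ ε > 0, Set.Ioo (1 - ε) (1 + ε) ⊆ Dom a b ∧
      StrictConvexOn ℝ (Set.Ioo (1 - ε) (1 + ε)) f)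
    (hz : zz f ∈ interior {z : ℝ | fStar f a b z < ⊤}) :
    rderiv (fStarR f a b) (zz f) = 1 := by
  set F := fStarR f a b
  set z₀ := zz f
  have hF := convexOn_fStarR (f := f) (a := a) (b := b) ha1 hb1 hf1
  have hF0 : F z₀ = z₀ := fStarR_zz ha1 hb1 hf1 hconv
  have h1 : 1 ≤ rderiv F z₀ := by
    rw [rderiv_eq_Ioi]
    have hd := hF.hasDerivWithinAt_rightDeriv_of_mem_interior hz
    rw [hasDerivWithinAt_iff_tendsto_slope' (by simp)] at hd
    refine ge_of_tendsto hd ?_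
    have hnear : ∀ᶠ z in 𝓝[>] z₀, z ∈ {z : ℝ | fStar f a b z < ⊤} :=
      nhdsWithin_le_nhds (mem_interior_iff_mem_nhds.1 hz)
    filter_upwards [hnear, self_mem_nhdsWithin] with z hz1 hz2
    have hz2 : z₀ < z := hz2
    rw [slope_def_field, le_div_iff₀ (by linarith)]
    have h1 : z ≤ F z := self_le_fStarR ha1 hb1 hf1 hz1
    change 1 * (z - z₀) ≤ F z - F z₀
    linarith
  refine le_antisymm ?_ h1
  by_contra! hgt
  obtain ⟨ε, hε, hsubD, hsc⟩ := hstrict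
  set s := rderiv F z₀
  have haff : ∀ t, 1 ≤ t → t ≤ s → t ∈ Dom a b → f t = z₀ * (t - 1) := by
    intro t ht1 hts htD
    have htI : t ∈ interior (Dom a b) := by rwa [(isOpen_Dom a b).interior_eq]
    apply le_antisymm
    · set z := rderiv f t
      have hle : ∀ u ∈ Dom a b, z * u - f u ≤ z * t - f t := fun u hu => by
        have := hconv.add_rderiv_mul_le htI hu
        linarith
      have hfin : fStar f a b z < ⊤ := (fStar_le_coe hle).trans_lt (EReal.coe_lt_top _)
      have hFz : F z ≤ z * t - f t := fStarR_le ha1 hb1 hf1 hle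
      have hs1 : F z₀ + s * (z - z₀) ≤ F z := hF.add_rderiv_mul_le hz hfin
      have hs2 := self_le_fStarR ha1 hb1 hf1 hfin
      have hs3 : z₀ + t * (z - z₀) ≤ F z := by
        rcases le_total z₀ z with hzz | hzz
        · nlinarith
        · have : z ≤ F z := hs2
          nlinarith
      linarith
    · have hone : (1 : ℝ) ∈ interior (Dom a b) := by
        rw [(isOpen_Dom a b).interior_eq]; exact ⟨ha1, hb1⟩
      have := hconv.add_rderiv_mul_le hone htD
      rw [hf1] at this
      change 0 + z₀ * (t - 1) ≤ f t at this
      linarith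
  set δ := min (s - 1) (ε / 2)
  have hδ : 0 < δ := lt_min (by linarith) (by linarith)
  have hδs : δ ≤ s - 1 := min_le_left _ _
  have hδε : δ ≤ ε / 2 := min_le_right _ _
  have m1 : (1 : ℝ) ∈ Set.Ioo (1 - ε) (1 + ε) := ⟨by linarith, by linarith⟩
  have m2 : 1 + δ ∈ Set.Ioo (1 - ε) (1 + ε) := ⟨by linarith, by linarith⟩
  have m3 : 1 + δ / 2 ∈ Set.Ioo (1 - ε) (1 + ε) := ⟨by linarith, by linarith⟩
  have hlt := hsc.2 m1 m2 (by linarith) (show (0 : ℝ) < 1 / 2 by norm_num)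
    (show (0 : ℝ) < 1 / 2 by norm_num) (by norm_num)
  have e : (1 / 2 : ℝ) • (1 : ℝ) + (1 / 2 : ℝ) • (1 + δ) = 1 + δ / 2 := by
    simp only [smul_eq_mul]; ring
  rw [e, haff (1 + δ / 2) (by linarith) (by linarith) (hsubD m3),
    haff (1 + δ) (by linarith) (by linarith) (hsubD m2), hf1] at hlt
  simp only [smul_eq_mul] at hlt
  nlinarith

end Legendre

/-- The properties of the Legendre transform `F` of `f` on `(-∞, z₀ + w]` used in the
concentration argument, with `L` a Lipschitz constant on `[z₀ - w, z₀ + w]`. -/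
structure IsLegendre (F : ℝ → ℝ) (z₀ w L : ℝ) : Prop where
  pos : 0 < w
  meas : Measurable F
  mono : ∀ x y, x ≤ y → y ≤ z₀ + w → F x ≤ F y
  self_le : ∀ z ≤ z₀ + w, z ≤ F z
  map_zero : F z₀ = z₀
  conv : ConvexOn ℝ (Iic (z₀ + w)) F
  nonneg : 0 ≤ L
  lip : ∀ x ∈ Icc (z₀ - w) (z₀ + w), ∀ y ∈ Icc (z₀ - w) (z₀ + w), |F x - F y| ≤ L * |x - y|

section Facts

variable {f : ℝ → ℝ} {a : ℝ} {b : EReal} {w : ℝ}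

lemma measurable_fStar (ha0 : 0 ≤ a) : Measurable (fStar f a b) := (monotone_fStar ha0).measurable

lemma measurable_fStarR (ha0 : 0 ≤ a) : Measurable (fStarR f a b) :=
  (measurable_fStar ha0).ereal_toReal

variable (ha0 : 0 ≤ a) (ha1 : a < 1) (hb1 : ((1 : ℝ) : EReal) < b) (hf1 : f 1 = 0)
  (hconv : ConvexOn ℝ (Dom a b) f) (hw : 0 < w)
  (hz : zz f + w ∈ interior {z : ℝ | fStar f a b z < ⊤})
include ha0 ha1 hb1 hf1 hconv hw hz

omit ha1 hb1 hf1 hconv hw in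
lemma Iic_subset_interior_finite : Iic (zz f + w) ⊆ interior {z : ℝ | fStar f a b z < ⊤} := by
  rw [mem_interior_iff_mem_nhds, Metric.mem_nhds_iff] at hz
  obtain ⟨ε, hε, hball⟩ := hz
  have hsub : Iio (zz f + w + ε / 2) ⊆ {z : ℝ | fStar f a b z < ⊤} := fun z hz' =>
    (monotone_fStar ha0 (le_of_lt hz')).trans_lt
      (hball (by rw [Metric.mem_ball, Real.dist_eq, add_sub_cancel_left, abs_of_pos] <;> linarith))
  exact fun z hz' => interior_maximal hsub isOpen_Iio (lt_of_le_of_lt (mem_Iic.1 hz') (by linarith))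

omit ha1 hb1 hf1 hconv hw in
lemma fStar_lt_top {z : ℝ} (h : z ≤ zz f + w) : fStar f a b z < ⊤ := by
  have h' := interior_subset (Iic_subset_interior_finite ha0 hz h)
  exact h'

lemma isLegendre_fStarR :
    IsLegendre (fStarR f a b) (zz f) w (rderiv (fStarR f a b) (zz f + w)) := by
  have hint := Iic_subset_interior_finite ha0 hz
  have hmono : ∀ x y, x ≤ y → y ≤ zz f + w → fStarR f a b x ≤ fStarR f a b y := fun x y hxy hy =>
    EReal.toReal_le_toReal (monotone_fStar ha0 hxy) (fStar_ne_bot ha1 hb1 hf1 x)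
      (fStar_lt_top ha0 hz hy).ne
  have hcv := convexOn_fStarR (f := f) (a := a) (b := b) ha1 hb1 hf1
  have hL : 0 ≤ rderiv (fStarR f a b) (zz f + w) := by
    have h := hcv.add_rderiv_mul_le (hint self_mem_Iic)
      (fStar_lt_top ha0 hz (show zz f ≤ zz f + w by linarith))
    have h2 := hmono (zz f) (zz f + w) (by linarith) le_rfl
    nlinarith
  have hlip : ∀ x y, x ≤ y → y ≤ zz f + w → fStarR f a b y - fStarR f a b x ≤
      rderiv (fStarR f a b) (zz f + w) * (y - x) := by
    intro x y hxy hy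
    rcases hxy.eq_or_lt with rfl | hlt
    · simp
    have hxf := fStar_lt_top ha0 hz (hxy.trans hy)
    have h1 := (hcv.slope_le_leftDeriv_of_mem_interior hxf (hint hy) hlt).trans
      (hcv.leftDeriv_le_rightDeriv_of_mem_interior (hint hy))
    have h2 := hcv.monotoneOn_rightDeriv (hint hy) (hint self_mem_Iic) hy
    rw [slope_def_field, div_le_iff₀ (by linarith)] at h1
    rw [rderiv_eq_Ioi]
    exact h1.trans (mul_le_mul_of_nonneg_right h2 (by linarith))
  refine ⟨hw, measurable_fStarR ha0, hmono,
    fun z h => self_le_fStarR ha1 hb1 hf1 (fStar_lt_top ha0 hz h),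
    fStarR_zz ha1 hb1 hf1 hconv,
    hcv.subset (hint.trans interior_subset) (convex_Iic _), hL, ?_⟩
  intro x hx y hy
  rcases le_total x y with h | h
  · rw [abs_sub_comm, abs_sub_comm x y, abs_of_nonneg (sub_nonneg.2 (hmono _ _ h hy.2)),
      abs_of_nonneg (sub_nonneg.2 h)]
    exact hlip _ _ h hy.2
  · rw [abs_of_nonneg (sub_nonneg.2 (hmono _ _ h hx.2)), abs_of_nonneg (sub_nonneg.2 h)]
    exact hlip _ _ h hx.2

lemma abs_fStarR_sub_id_le
    (hstrict : ∃ ε > 0, Set.Ioo (1 - ε) (1 + ε) ⊆ Dom a b ∧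
      StrictConvexOn ℝ (Set.Ioo (1 - ε) (1 + ε)) f)
    {M : ℝ≥0} (hM : LipschitzOnWith M (rderiv (fStarR f a b)) (Icc (zz f - w) (zz f + w)))
    (x : ℝ) (hx : x ∈ Icc (zz f - w) (zz f + w)) (y : ℝ) (hy : y ∈ Icc (zz f - w) (zz f + w)) :
    |(fStarR f a b x - x) - (fStarR f a b y - y)| ≤ M * w * |x - y| := by
  have hint := Iic_subset_interior_finite ha0 hz
  have hcv := convexOn_fStarR (f := f) (a := a) (b := b) ha1 hb1 hf1
  have hone := rderiv_fStarR_zz ha1 hb1 hf1 hconv hstrict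
    (hint (show zz f ≤ zz f + w by linarith))
  have hbd : ∀ u ∈ Icc (zz f - w) (zz f + w), |rderiv (fStarR f a b) u - 1| ≤ M * w := by
    intro u hu
    have h := hM.dist_le_mul u hu (zz f) ⟨by linarith, by linarith⟩
    rw [hone, Real.dist_eq, Real.dist_eq] at h
    refine h.trans (mul_le_mul_of_nonneg_left ?_ M.2)
    rw [abs_le]
    constructor <;> linarith [hu.1, hu.2]
  have key : ∀ x ∈ Icc (zz f - w) (zz f + w), ∀ y ∈ Icc (zz f - w) (zz f + w), x ≤ y →
      |(fStarR f a b x - x) - (fStarR f a b y - y)| ≤ M * w * |x - y| := by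
    intro x hx y hy hxy
    have h1 := hcv.add_rderiv_mul_le (hint hx.2) (fStar_lt_top ha0 hz hy.2)
    have h2 := hcv.add_rderiv_mul_le (hint hy.2) (fStar_lt_top ha0 hz hx.2)
    have h3 := (abs_le.1 (hbd x hx)).1
    have h4 := (abs_le.1 (hbd y hy)).2
    rw [abs_sub_comm x y, abs_of_nonneg (sub_nonneg.2 hxy), abs_le]
    have h5 := mul_le_mul_of_nonneg_right h3 (sub_nonneg.2 hxy)
    have h6 := mul_le_mul_of_nonneg_right h4 (sub_nonneg.2 hxy)
    constructor <;> linarith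
  rcases le_total x y with h | h
  · exact key x hx y hy h
  · rw [abs_sub_comm, abs_sub_comm x y]
    exact key y hy x hx h

end Facts

section Convexity

lemma ConvexOn.add_le_add_of_add_eq {S : Set ℝ} {g : ℝ → ℝ} (hg : ConvexOn ℝ S g)
    {x y₁ y₂ v : ℝ} (hx : x ∈ S) (hv : v ∈ S) (h₁ : y₁ ∈ Icc x v) (h : y₁ + y₂ = x + v) :
    g y₁ + g y₂ ≤ g x + g v := by
  rw [← segment_eq_Icc (h₁.1.trans h₁.2)] at h₁
  obtain ⟨p, q, hp, hq, hpq, rfl⟩ := h₁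
  simp only [smul_eq_mul] at h ⊢
  have e : y₂ = q * x + p * v := by linear_combination h + (-x - v) * hpq
  have h1 := hg.2 hx hv hp hq hpq
  have h2 := hg.2 hx hv hq hp (by rwa [add_comm])
  simp only [smul_eq_mul] at h1 h2
  rw [e]
  calc _ ≤ _ := add_le_add h1 h2
    _ = (p + q) * g x + (p + q) * g v := by ring
    _ = _ := by rw [hpq]; ring

lemma ConvexOn.sub_id_le_of_mem_uIcc {S : Set ℝ} {g : ℝ → ℝ} (hg : ConvexOn ℝ S g) {z₀ z z' : ℝ}
    (hz₀ : z₀ ∈ S) (hz : z ∈ S) (h0 : g z₀ = z₀) (hle : z ≤ g z) (h : z' ∈ uIcc z₀ z) :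
    g z' - z' ≤ g z - z := by
  rw [← segment_eq_uIcc] at h
  obtain ⟨p, q, hp, hq, hpq, rfl⟩ := h
  have h1 := hg.2 hz₀ hz hp hq hpq
  simp only [smul_eq_mul, h0] at h1 ⊢
  nlinarith

end Convexity

section EmpiricalMeasure

variable {Y : Type*} [MeasurableSpace Y] {m : ℕ}

lemma isProbabilityMeasure_empMeas (hm : 0 < m) (y : Fin m → Y) :
    IsProbabilityMeasure (empMeas m y) := by
  constructor
  simp only [empMeas, Measure.smul_apply, Measure.finsetSum_apply, measure_univ, Finset.sum_const,
    Finset.card_univ, Fintype.card_fin, nsmul_eq_mul, mul_one, smul_eq_mul]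
  exact ENNReal.inv_mul_cancel (by exact_mod_cast hm.ne') (ENNReal.natCast_ne_top m)

lemma integral_empMeas (y : Fin m → Y) {g : Y → ℝ} (hg : Measurable g) :
    ∫ x, g x ∂(empMeas m y) = (m : ℝ)⁻¹ * ∑ i, g (y i) := by
  have hi : ∀ i ∈ (Finset.univ : Finset (Fin m)), Integrable g (Measure.dirac (y i)) := by
    intro i _
    exact (integrable_const (g (y i))).congr
      (by rw [Filter.EventuallyEq, ae_dirac_iff (measurableSet_eq_fun measurable_const hg)])
  rw [empMeas, integral_smul_measure, integral_finsetSum_measure hi]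
  simp [integral_dirac' g _ hg.stronglyMeasurable]

end EmpiricalMeasure

/-- The generalized cumulant generating function, as an infimum over a compact interval. -/
noncomputable def lam (F : ℝ → ℝ) (α β z₀ : ℝ) {Y : Type*} [MeasurableSpace Y] (P : Measure Y)
    (ψ : Y → ℝ) : ℝ :=
  ⨅ ν : Icc (α - z₀) (β - z₀), ((ν : ℝ) + ∫ y, F (ψ y - ν) ∂P)

section Lam

variable {F : ℝ → ℝ} {α β z₀ L : ℝ} (hF : IsLegendre F z₀ (β - α) L)
include hF

lemma IsLegendre.Icc_nonempty : Nonempty (Icc (α - z₀) (β - z₀)) :=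
  ⟨α - z₀, le_rfl, by linarith [hF.pos]⟩

omit hF in
lemma sub_mem_Icc {u ν : ℝ} (hu : u ∈ Icc α β) (hν : ν ∈ Icc (α - z₀) (β - z₀)) :
    u - ν ∈ Icc (z₀ - (β - α)) (z₀ + (β - α)) :=
  ⟨by linarith [hu.1, hν.2], by linarith [hu.2, hν.1]⟩

lemma IsLegendre.mem_Icc {x : ℝ} (hx : x ∈ Icc (z₀ - (β - α)) (z₀ + (β - α))) :
    F x ∈ Icc (F (z₀ - (β - α))) (F (z₀ + (β - α))) :=
  ⟨hF.mono _ _ hx.1 hx.2, hF.mono _ _ hx.2 le_rfl⟩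

variable {Y : Type*} [MeasurableSpace Y] {P : Measure Y} {ψ : Y → ℝ}
  (hψ : Measurable ψ) (hψb : ∀ y, ψ y ∈ Icc α β)
include hψ hψb

omit hψb in
lemma IsLegendre.measurable_comp (ν : ℝ) : Measurable fun y => F (ψ y - ν) :=
  hF.meas.comp (hψ.sub_const ν)

variable [IsProbabilityMeasure P]

lemma IsLegendre.integrable_comp {ν : ℝ} (hν : ν ∈ Icc (α - z₀) (β - z₀)) :
    Integrable (fun y => F (ψ y - ν)) P :=
  Integrable.of_mem_Icc _ _ (hF.measurable_comp hψ ν).aemeasurable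
    (ae_of_all _ fun y => hF.mem_Icc (sub_mem_Icc (hψb y) hν))

omit hF in
lemma integrable_of_mem_Icc : Integrable ψ P :=
  Integrable.of_mem_Icc _ _ hψ.aemeasurable (ae_of_all _ hψb)

lemma IsLegendre.le_add_integral {ν : ℝ} (hν : ν ∈ Icc (α - z₀) (β - z₀)) :
    α ≤ ν + ∫ y, F (ψ y - ν) ∂P := by
  have h : ∫ _, (α - ν) ∂P ≤ ∫ y, F (ψ y - ν) ∂P :=
    integral_mono (integrable_const _) (hF.integrable_comp hψ hψb hν) fun y =>
      (sub_le_sub_right (hψb y).1 ν).trans (hF.self_le _ (sub_mem_Icc (hψb y) hν).2)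
  simp at h
  linarith

lemma IsLegendre.bddBelow :
    BddBelow (range fun ν : Icc (α - z₀) (β - z₀) => (ν : ℝ) + ∫ y, F (ψ y - ν) ∂P) :=
  ⟨α, by rintro _ ⟨ν, rfl⟩; exact hF.le_add_integral hψ hψb ν.2⟩

lemma IsLegendre.lam_le {ν : ℝ} (hν : ν ∈ Icc (α - z₀) (β - z₀)) :
    lam F α β z₀ P ψ ≤ ν + ∫ y, F (ψ y - ν) ∂P :=
  ciInf_le (hF.bddBelow hψ hψb) ⟨ν, hν⟩

omit [IsProbabilityMeasure P] hψ hψb in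
lemma IsLegendre.le_lam {c : ℝ}
    (h : ∀ ν ∈ Icc (α - z₀) (β - z₀), c ≤ ν + ∫ y, F (ψ y - ν) ∂P) : c ≤ lam F α β z₀ P ψ :=
  have := hF.Icc_nonempty
  le_ciInf fun ν => h ν ν.2

lemma IsLegendre.lam_mem_Icc : lam F α β z₀ P ψ ∈ Icc α β := by
  refine ⟨hF.le_lam fun ν hν => hF.le_add_integral hψ hψb hν, ?_⟩
  have hν : β - z₀ ∈ Icc (α - z₀) (β - z₀) := ⟨by linarith [hF.pos], le_rfl⟩
  refine (hF.lam_le hψ hψb hν).trans ?_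
  have h : ∫ y, F (ψ y - (β - z₀)) ∂P ≤ ∫ _, z₀ ∂P :=
    integral_mono (hF.integrable_comp hψ hψb hν) (integrable_const _) fun y => by
      have := hF.mono (ψ y - (β - z₀)) z₀ (by linarith [(hψb y).2]) (by linarith [hF.pos])
      rwa [hF.map_zero] at this
  simp at h
  linarith

lemma IsLegendre.lam_le_lam_add {ψ' : Y → ℝ} (hψ' : Measurable ψ') (hψb' : ∀ y, ψ' y ∈ Icc α β) :
    lam F α β z₀ P ψ ≤ lam F α β z₀ P ψ' + L * ∫ y, |ψ y - ψ' y| ∂P := by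
  rw [← sub_le_iff_le_add]
  refine hF.le_lam fun ν hν => ?_
  rw [sub_le_iff_le_add]
  refine (hF.lam_le hψ hψb hν).trans ?_
  have hi : Integrable (fun y => |ψ y - ψ' y|) P :=
    ((integrable_of_mem_Icc hψ hψb).sub (integrable_of_mem_Icc hψ' hψb')).abs
  have h : ∫ y, F (ψ y - ν) ∂P ≤ ∫ y, (F (ψ' y - ν) + L * |ψ y - ψ' y|) ∂P := by
    refine integral_mono (hF.integrable_comp hψ hψb hν)
      ((hF.integrable_comp hψ' hψb' hν).add (hi.const_mul L)) fun y => ?_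
    have := (abs_le.1 (hF.lip _ (sub_mem_Icc (hψb y) hν) _ (sub_mem_Icc (hψb' y) hν))).2
    rw [sub_sub_sub_cancel_right] at this
    change F (ψ y - ν) ≤ F (ψ' y - ν) + L * |ψ y - ψ' y|
    linarith
  rw [integral_add (hF.integrable_comp hψ' hψb' hν) (hi.const_mul L), integral_const_mul] at h
  linarith

lemma IsLegendre.tendsto_lam {s : ℕ → Y → ℝ} (hs : ∀ j, Measurable (s j))
    (hsb : ∀ j y, s j y ∈ Icc α β) (hlim : ∀ y, Tendsto (fun j => s j y) atTop (𝓝 (ψ y))) :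
    Tendsto (fun j => lam F α β z₀ P (s j)) atTop (𝓝 (lam F α β z₀ P ψ)) := by
  have h0 : Tendsto (fun j => ∫ y, |s j y - ψ y| ∂P) atTop (𝓝 (∫ _, (0 : ℝ) ∂P)) := by
    refine tendsto_integral_of_dominated_convergence (fun _ => β - α)
      (fun j => ((hs j).sub hψ).abs.aestronglyMeasurable) (integrable_const _) ?_ ?_
    · refine fun j => ae_of_all _ fun y => ?_
      rw [Real.norm_eq_abs, abs_abs, abs_le]
      constructor <;> linarith [(hsb j y).1, (hsb j y).2, (hψb y).1, (hψb y).2]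
    · refine ae_of_all _ fun y => ?_
      have := ((hlim y).sub_const (ψ y)).abs
      simpa using this
  have h1 := h0.const_mul L
  simp only [integral_zero, mul_zero] at h1
  rw [tendsto_iff_dist_tendsto_zero]
  refine squeeze_zero (fun _ => dist_nonneg) (fun j => ?_) h1
  rw [Real.dist_eq, abs_le]
  have e1 := hF.lam_le_lam_add (P := P) (hs j) (hsb j) hψ hψb
  have e2 := hF.lam_le_lam_add (P := P) hψ hψb (hs j) (hsb j)
  simp only [abs_sub_comm (ψ _)] at e2
  constructor <;> linarith

lemma IsLegendre.exists_nat_lt {ν ε : ℝ} (hν : ν ∈ Icc (α - z₀) (β - z₀)) (hε : 0 < ε)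
    {c : ℕ → Icc (α - z₀) (β - z₀)} (hc : DenseRange c) :
    ∃ q, (c q : ℝ) + ∫ y, F (ψ y - c q) ∂P < ν + ∫ y, F (ψ y - ν) ∂P + ε := by
  obtain ⟨q, hq⟩ := Metric.denseRange_iff.1 hc ⟨ν, hν⟩ (ε / (1 + L))
    (div_pos hε (by linarith [hF.nonneg]))
  refine ⟨q, ?_⟩
  rw [Subtype.dist_eq, Real.dist_eq, lt_div_iff₀ (by linarith [hF.nonneg])] at hq
  simp only at hq
  have h : ∫ y, F (ψ y - c q) ∂P ≤ ∫ y, (F (ψ y - ν) + L * |ν - c q|) ∂P := by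
    refine integral_mono (hF.integrable_comp hψ hψb (c q).2)
      ((hF.integrable_comp hψ hψb hν).add (integrable_const _)) fun y => ?_
    have := (abs_le.1 (hF.lip _ (sub_mem_Icc (hψb y) (c q).2) _ (sub_mem_Icc (hψb y) hν))).2
    rw [sub_sub_sub_cancel_left] at this
    change F (ψ y - c q) ≤ F (ψ y - ν) + L * |ν - c q|
    linarith
  rw [integral_add (hF.integrable_comp hψ hψb hν) (integrable_const _)] at h
  simp at h
  have := neg_abs_le (ν - c q)
  linarith

lemma IsLegendre.lam_eq_iInf_nat {c : ℕ → Icc (α - z₀) (β - z₀)} (hc : DenseRange c) :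
    lam F α β z₀ P ψ = ⨅ q, ((c q : ℝ) + ∫ y, F (ψ y - c q) ∂P) := by
  apply le_antisymm
  · exact le_ciInf fun q => hF.lam_le hψ hψb (c q).2
  · refine hF.le_lam fun ν hν => le_of_forall_pos_le_add fun ε hε => ?_
    obtain ⟨q, hq⟩ := hF.exists_nat_lt (P := P) hψ hψb hν hε hc
    refine (ciInf_le ⟨α, ?_⟩ q).trans hq.le
    rintro _ ⟨q, rfl⟩
    exact hF.le_add_integral hψ hψb (c q).2

omit hψb in
lemma IsLegendre.lam_map {W : Type*} [MeasurableSpace W] {R : Measure W}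
    {φ : W → Y} (hφ : Measurable φ) :
    lam F α β z₀ (Measure.map φ R) ψ = lam F α β z₀ R (fun w => ψ (φ w)) := by
  unfold lam
  congr 1
  ext ν
  rw [integral_map hφ.aemeasurable
    (hF.measurable_comp hψ ν).aestronglyMeasurable]

lemma IsLegendre.measurable_lam_empMeas {m : ℕ} (hm : 0 < m) :
    Measurable fun y : Fin m → Y => lam F α β z₀ (empMeas m y) ψ := by
  have := hF.Icc_nonempty
  have : ∀ y : Fin m → Y, lam F α β z₀ (empMeas m y) ψ = ⨅ q, ((TopologicalSpace.denseSeq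
      (Icc (α - z₀) (β - z₀)) q : ℝ) + (m : ℝ)⁻¹ *
      ∑ i, F (ψ (y i) - TopologicalSpace.denseSeq (Icc (α - z₀) (β - z₀)) q)) := by
    intro y
    have := isProbabilityMeasure_empMeas hm y
    rw [hF.lam_eq_iInf_nat hψ hψb (TopologicalSpace.denseRange_denseSeq _)]
    congr 1
    ext q
    rw [integral_empMeas y (hF.measurable_comp hψ _)]
  simp_rw [this]
  refine Measurable.iInf fun q => measurable_const.add (measurable_const.mul ?_)
  exact Finset.measurable_sum _ fun i _ =>
    hF.meas.comp ((hψ.comp (measurable_pi_apply i)).sub_const _)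

lemma IsLegendre.lam_empMeas_update_le {m : ℕ} (hm : 0 < m) (y : Fin m → Y) (j : Fin m) (v : Y)
    {z : ℝ} (hz : z ∈ Icc (z₀ - (β - α)) z₀) :
    lam F α β z₀ (empMeas m (Function.update y j v)) ψ ≤ lam F α β z₀ (empMeas m y) ψ +
      (-z + (((m : ℝ) - 1) / m) * F z + (1 / (m : ℝ)) * F (β - α + z)) := by
  have := isProbabilityMeasure_empMeas hm y
  have := isProbabilityMeasure_empMeas hm (Function.update y j v)
  have hm' : (0 : ℝ) < m := by exact_mod_cast hm
  rw [← sub_le_iff_le_add]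
  refine hF.le_lam fun ν₂ hν₂ => ?_
  set ν₁ := α - z with hν₁_def
  have hν₁ : ν₁ ∈ Icc (α - z₀) (β - z₀) := ⟨by linarith [hz.2], by linarith [hz.1]⟩
  have hmax : max ν₁ ν₂ ∈ Icc (α - z₀) (β - z₀) :=
    ⟨le_max_of_le_left hν₁.1, max_le hν₁.2 hν₂.2⟩
  have hmin : min ν₁ ν₂ ∈ Icc (α - z₀) (β - z₀) :=
    ⟨le_min hν₁.1 hν₂.1, min_le_of_left_le hν₁.2⟩
  have hlam := hF.lam_le (P := empMeas m (Function.update y j v)) hψ hψb hmax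
  rw [integral_empMeas _ (hF.measurable_comp hψ _)] at hlam
  rw [integral_empMeas _ (hF.measurable_comp hψ _)]
  have hα : α ∈ Icc α β := ⟨le_rfl, by linarith [hF.pos]⟩
  have hβ : β ∈ Icc α β := ⟨by linarith [hF.pos], le_rfl⟩
  have up : ∀ {u ν}, u ∈ Icc α β → ν ∈ Icc (α - z₀) (β - z₀) → u - ν ≤ z₀ + (β - α) :=
    fun hu hν => (sub_mem_Icc hu hν).2
  have key : ∑ i, (F (ψ (Function.update y j v i) - max ν₁ ν₂) + F (α - min ν₁ ν₂)) ≤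
      ∑ i, (F (ψ (y i) - ν₂) + F ((if i = j then β else α) - ν₁)) := by
    refine Finset.sum_le_sum fun i _ => ?_
    rcases le_total ν₁ ν₂ with h | h
    · rw [max_eq_right h, min_eq_left h]
      rcases eq_or_ne i j with rfl | hij
      · rw [Function.update_self, if_pos rfl]
        have h1 := hF.mono (ψ v - ν₂) (β - ν₂) (by linarith [(hψb v).2]) (up hβ hν₂)
        have h2 := hF.mono (α - ν₂) (ψ (y i) - ν₂) (by linarith [(hψb (y i)).1])
          (up (hψb _) hν₂)
        have h3 := hF.conv.add_le_add_of_add_eq (x := α - ν₂) (v := β - ν₁) (y₁ := β - ν₂)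
          (y₂ := α - ν₁) (up hα hν₂) (up hβ hν₁) ⟨by linarith [hF.pos], by linarith⟩ (by ring)
        linarith
      · rw [Function.update_of_ne hij, if_neg hij]
    · rw [max_eq_left h, min_eq_right h]
      rcases eq_or_ne i j with rfl | hij
      · rw [Function.update_self, if_pos rfl]
        have h1 := hF.mono (ψ v - ν₁) (β - ν₁) (by linarith [(hψb v).2]) (up hβ hν₁)
        have h2 := hF.mono (α - ν₂) (ψ (y i) - ν₂) (by linarith [(hψb (y i)).1])
          (up (hψb _) hν₂)
        linarith
      · rw [Function.update_of_ne hij, if_neg hij]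
        have h3 := hF.conv.add_le_add_of_add_eq (x := α - ν₁) (v := ψ (y i) - ν₂)
          (y₁ := ψ (y i) - ν₁) (y₂ := α - ν₂) (up hα hν₁) (up (hψb _) hν₂)
          ⟨by linarith [(hψb (y i)).1], by linarith⟩ (by ring)
        linarith
  have hsum : ∑ i, F ((if i = j then β else α) - ν₁) = (m - 1) * F z + F (β - α + z) := by
    have : ∀ i : Fin m, F ((if i = j then β else α) - ν₁) =
        F z + if i = j then F (β - α + z) - F z else 0 := by
      intro i
      split_ifs
      · rw [show β - ν₁ = β - α + z by rw [hν₁_def]; ring]; ring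
      · rw [show α - ν₁ = z by rw [hν₁_def]; ring]; ring
    simp only [this, Finset.sum_add_distrib, Finset.sum_ite_eq', Finset.mem_univ, if_true]
    simp
    ring
  rw [Finset.sum_add_distrib, Finset.sum_add_distrib, hsum] at key
  simp only [Finset.sum_const, Finset.card_univ, Fintype.card_fin, nsmul_eq_mul] at key
  have h4 := hF.self_le (α - min ν₁ ν₂) (up hα hmin)
  have h5 : max ν₁ ν₂ + min ν₁ ν₂ = ν₁ + ν₂ := max_add_min _ _
  have h6 := mul_le_mul_of_nonneg_left key (inv_nonneg.2 hm'.le)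
  have h7 : (m : ℝ)⁻¹ * m = 1 := inv_mul_cancel₀ hm'.ne'
  have e1 : (((m : ℝ) - 1) / m) * F z + (1 / (m : ℝ)) * F (β - α + z) =
      (m : ℝ)⁻¹ * ((m - 1) * F z + F (β - α + z)) := by field_simp
  have e2 : (m : ℝ)⁻¹ * (m * F (α - min ν₁ ν₂)) = F (α - min ν₁ ν₂) := by
    rw [← mul_assoc, h7, one_mul]
  rw [mul_add, e2, mul_add] at h6
  rw [add_assoc (-z), e1]
  linarith

end Lam

lemma cgfR_eq_lam {f : ℝ → ℝ} {a : ℝ} {b : EReal} {α β L : ℝ} (ha1 : a < 1)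
    (hb1 : ((1 : ℝ) : EReal) < b) (hf1 : f 1 = 0)
    (hfin : ∀ z ≤ zz f + (β - α), fStar f a b z < ⊤)
    (hF : IsLegendre (fStarR f a b) (zz f) (β - α) L)
    {Y : Type*} [MeasurableSpace Y] {P : Measure Y} [IsProbabilityMeasure P] {ψ : Y → ℝ}
    (hψ : Measurable ψ) (hψb : ∀ y, ψ y ∈ Icc α β) :
    cgfR f a b P ψ = lam (fStarR f a b) α β (zz f) P ψ := by
  have hle : ∀ ν ∈ Icc (α - zz f) (β - zz f),
      cgf f a b P ψ ≤ ((ν + ∫ y, fStarR f a b (ψ y - ν) ∂P : ℝ) : EReal) := by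
    intro ν hν
    refine (iInf_le _ ν).trans (le_of_eq ?_)
    rw [eIntegral, if_pos ⟨ae_of_all _ fun y => (hfin _ (sub_mem_Icc (hψb y) hν).2).ne,
      hF.integrable_comp hψ hψb hν⟩, EReal.coe_add]
    rfl
  have hge : ((lam (fStarR f a b) α β (zz f) P ψ : ℝ) : EReal) ≤ cgf f a b P ψ := by
    refine le_iInf fun ν => ?_
    unfold eIntegral
    split_ifs with h
    · rw [← EReal.coe_add, EReal.coe_le_coe_iff]
      set ν' : ℝ := max (α - zz f) (min (β - zz f) ν) with hν'_def
      have hν' : ν' ∈ Icc (α - zz f) (β - zz f) :=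
        ⟨le_max_left _ _, max_le (by linarith [hF.pos]) (min_le_left _ _)⟩
      refine (hF.lam_le hψ hψb hν').trans ?_
      have hint : ∫ y, fStarR f a b (ψ y - ν') ∂P ≤
          ∫ y, ((fStarR f a b (ψ y - ν)) + (ν - ν')) ∂P := by
        refine integral_mono_ae (hF.integrable_comp hψ hψb hν') (h.2.add (integrable_const _)) ?_
        filter_upwards [h.1] with y hy
        have hmem : ψ y - ν' ∈ uIcc (zz f) (ψ y - ν) := by
          rw [mem_uIcc]
          rcases le_total ν (α - zz f) with h1 | h1
          · have : ν' = α - zz f := by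
              rw [hν'_def, max_eq_left]; exact (min_le_right _ _).trans h1
            left; constructor <;> linarith [(hψb y).1]
          · rcases le_total ν (β - zz f) with h2 | h2
            · have : ν' = ν := by rw [hν'_def, min_eq_right h2, max_eq_right h1]
              rw [this]
              rcases le_total (zz f) (ψ y - ν) with h3 | h3
              · exact Or.inl ⟨h3, le_rfl⟩
              · exact Or.inr ⟨le_rfl, h3⟩
            · have : ν' = β - zz f := by
                rw [hν'_def, min_eq_left h2, max_eq_right (by linarith [hF.pos])]
              right; constructor <;> linarith [(hψb y).2]
        have hy' : fStar f a b (ψ y - ν) < ⊤ := lt_top_iff_ne_top.2 hy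
        have := (convexOn_fStarR (f := f) (a := a) (b := b) ha1 hb1 hf1).sub_id_le_of_mem_uIcc
          (hfin (zz f) (by linarith [hF.pos])) hy' hF.map_zero
          (self_le_fStarR ha1 hb1 hf1 hy') hmem
        linarith
      have h2 : Integrable (fun y => fStarR f a b (ψ y - ν)) P := h.2
      rw [integral_add h2 (integrable_const _)] at hint
      simp at hint
      change _ ≤ ν + ∫ y, fStarR f a b (ψ y - ν) ∂P
      linarith
    · rw [EReal.coe_add_top]
      exact le_top
  have htop : cgf f a b P ψ ≠ ⊤ :=
    ((hle (α - zz f) ⟨le_rfl, by linarith [hF.pos]⟩).trans_lt (EReal.coe_lt_top _)).ne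
  have hbot : cgf f a b P ψ ≠ ⊥ := fun h => by simp [h] at hge
  have hcoe : (cgfR f a b P ψ : EReal) = cgf f a b P ψ := EReal.coe_toReal htop hbot
  apply le_antisymm
  · refine hF.le_lam fun ν hν => ?_
    have := hle ν hν
    rw [← hcoe] at this
    exact_mod_cast this
  · rw [← hcoe] at hge
    exact_mod_cast hge

section RademacherAverage

/-- The sign `1` or `-1` attached to a Boolean. -/
noncomputable def rsign (b : Bool) : ℝ := if b then 1 else -1

@[simp] lemma rsign_not (b : Bool) : rsign (!b) = -rsign b := by cases b <;> simp [rsign]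

lemma rsign_mul_self (b : Bool) : rsign b * rsign b = 1 := by cases b <;> simp [rsign]

lemma abs_rsign (b : Bool) : |rsign b| = 1 := by cases b <;> simp [rsign]

/-- The average over signs of the supremum over a family of vectors of the signed sums of their
coordinates. -/
noncomputable def radAvg {ι : Type*} {n : ℕ} (T : ι → Fin n → ℝ) : ℝ :=
  (2 ^ n : ℝ)⁻¹ * ∑ σ : Fin n → Bool, ⨆ i, ∑ j, rsign (σ j) * T i j

variable {ι κ : Type*} {n : ℕ}

lemma abs_signed_sum_le {t : Fin n → ℝ} {C : ℝ} (h : ∀ j, |t j| ≤ C) (σ : Fin n → Bool) :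
    |∑ j, rsign (σ j) * t j| ≤ n * C := by
  refine (Finset.abs_sum_le_sum_abs _ _).trans ?_
  refine (Finset.sum_le_sum fun j _ => (?_ : _ ≤ C)).trans (by simp)
  rw [abs_mul, abs_rsign, one_mul]
  exact h j

lemma bddAbove_signed_sum {T : ι → Fin n → ℝ} {C : ℝ} (h : ∀ i j, |T i j| ≤ C)
    (σ : Fin n → Bool) : BddAbove (range fun i => ∑ j, rsign (σ j) * T i j) :=
  ⟨n * C, by rintro _ ⟨i, rfl⟩; exact (abs_le.1 (abs_signed_sum_le (h i) σ)).2⟩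

lemma sum_flip (j : Fin n) (G : (Fin n → Bool) → ℝ) :
    ∑ σ, G (Function.update σ j (!σ j)) = ∑ σ, G σ := by
  have hinv : Function.Involutive fun σ : Fin n → Bool => Function.update σ j (!σ j) := by
    intro σ
    simp
  exact Equiv.sum_comp hinv.toPerm G

lemma sum_flip_all (G : (Fin n → Bool) → ℝ) : ∑ σ : Fin n → Bool, G (fun j => !σ j) = ∑ σ, G σ := by
  have hinv : Function.Involutive fun (σ : Fin n → Bool) (j : Fin n) => !σ j := by
    intro σ
    simp
  exact Equiv.sum_comp hinv.toPerm G

lemma radAvg_neg (T : ι → Fin n → ℝ) : radAvg (fun i j => -T i j) = radAvg T := by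
  unfold radAvg
  rw [← sum_flip_all]
  simp

lemma radAvg_const_mul {c : ℝ} (hc : 0 ≤ c) (T : ι → Fin n → ℝ) :
    radAvg (fun i j => c * T i j) = c * radAvg T := by
  unfold radAvg
  have : ∀ σ : Fin n → Bool, ⨆ i, ∑ j, rsign (σ j) * (c * T i j) =
      c * ⨆ i, ∑ j, rsign (σ j) * T i j := by
    intro σ
    rw [Real.mul_iSup_of_nonneg hc]
    congr 1
    ext i
    rw [Finset.mul_sum]
    exact Finset.sum_congr rfl fun j _ => by ring
  simp only [this, ← Finset.mul_sum]
  ring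

lemma radAvg_le_add {μ : Type*} [Nonempty μ] {S : ι → Fin n → ℝ} {T : κ → Fin n → ℝ}
    {U : μ → Fin n → ℝ} {C D : ℝ} (hS : ∀ i j, |S i j| ≤ C) (hT : ∀ i j, |T i j| ≤ D)
    (p : μ → ι) (q : μ → κ) (h : ∀ k j, U k j = S (p k) j + T (q k) j) :
    radAvg U ≤ radAvg S + radAvg T := by
  unfold radAvg
  rw [← mul_add, ← Finset.sum_add_distrib]
  refine mul_le_mul_of_nonneg_left (Finset.sum_le_sum fun σ _ => ?_) (by positivity)
  refine ciSup_le fun k => ?_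
  simp only [h, mul_add, Finset.sum_add_distrib]
  exact add_le_add (le_ciSup (bddAbove_signed_sum hS σ) (p k))
    (le_ciSup (bddAbove_signed_sum hT σ) (q k))

lemma abs_radAvg_le [Nonempty ι] {T : ι → Fin n → ℝ} {C : ℝ} (hT : ∀ i j, |T i j| ≤ C) :
    |radAvg T| ≤ n * C := by
  have hsum : ∀ G : (Fin n → Bool) → ℝ, (∀ σ, |G σ| ≤ n * C) →
      |(2 ^ n : ℝ)⁻¹ * ∑ σ, G σ| ≤ n * C := by
    intro G hG
    rw [abs_mul, abs_of_nonneg (by positivity), inv_mul_le_iff₀ (by positivity)]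
    refine (Finset.abs_sum_le_sum_abs _ _).trans ((Finset.sum_le_sum fun σ _ => hG σ).trans ?_)
    simp
  refine hsum _ fun σ => ?_
  rw [abs_le]
  obtain ⟨i⟩ := ‹Nonempty ι›
  have : Nonempty ι := ⟨i⟩
  exact ⟨(abs_le.1 (abs_signed_sum_le (hT i) σ)).1.trans (le_ciSup (bddAbove_signed_sum hT σ) i),
    ciSup_le fun i => (abs_le.1 (abs_signed_sum_le (hT i) σ)).2⟩

lemma sum_rsign (j : Fin n) : ∑ σ : Fin n → Bool, rsign (σ j) = 0 := by
  have := sum_flip j fun σ => rsign (σ j)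
  simp only [Function.update_self, rsign_not, Finset.sum_neg_distrib] at this
  linarith

lemma sum_rsign_mul_rsign {i j : Fin n} (h : i ≠ j) :
    ∑ σ : Fin n → Bool, rsign (σ i) * rsign (σ j) = 0 := by
  have := sum_flip j fun σ => rsign (σ i) * rsign (σ j)
  simp only [Function.update_self, Function.update_of_ne h, rsign_not, mul_neg,
    Finset.sum_neg_distrib] at this
  linarith

lemma radAvg_nonneg [Nonempty ι] {T : ι → Fin n → ℝ} {C : ℝ} (hT : ∀ i j, |T i j| ≤ C) :
    0 ≤ radAvg T := by
  obtain ⟨i⟩ := ‹Nonempty ι›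
  refine mul_nonneg (by positivity) ?_
  have h : ∑ σ : Fin n → Bool, ∑ j, rsign (σ j) * T i j = 0 := by
    rw [Finset.sum_comm]
    simp only [← Finset.sum_mul, sum_rsign, zero_mul, Finset.sum_const_zero]
  rw [← h]
  exact Finset.sum_le_sum fun σ _ => le_ciSup (bddAbove_signed_sum hT σ) i

lemma sum_sq_signed_sum : ∑ σ : Fin n → Bool, (∑ j, rsign (σ j)) ^ 2 = 2 ^ n * n := by
  have h : ∀ σ : Fin n → Bool, (∑ j, rsign (σ j)) ^ 2 = ∑ i, ∑ j, rsign (σ i) * rsign (σ j) := by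
    intro σ
    rw [sq, Finset.sum_mul_sum]
  simp only [h]
  rw [Finset.sum_comm]
  have h2 : ∀ i : Fin n, ∑ σ : Fin n → Bool, ∑ j, rsign (σ i) * rsign (σ j) = 2 ^ n := by
    intro i
    rw [Finset.sum_comm, Finset.sum_eq_single i]
    · simp [rsign_mul_self]
    · exact fun j _ hj => sum_rsign_mul_rsign hj.symm
    · simp
  simp [h2, mul_comm]

lemma sum_abs_signed_sum_le :
    (2 ^ n : ℝ)⁻¹ * ∑ σ : Fin n → Bool, |∑ j, rsign (σ j)| ≤ √n := by
  apply Real.le_sqrt_of_sq_le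
  have h := sq_sum_le_card_mul_sum_sq (s := Finset.univ)
    (f := fun σ : Fin n → Bool => |∑ j, rsign (σ j)|)
  simp only [sq_abs, sum_sq_signed_sum, Finset.card_univ, Fintype.card_pi, Fintype.card_bool,
    Finset.prod_const, Fintype.card_fin] at h
  push_cast at h
  rw [mul_pow, inv_pow, inv_mul_le_iff₀ (by positivity)]
  linarith

lemma radAvg_const_le [Nonempty ι] {c : ι → ℝ} {u r : ℝ} (h : ∀ i, |c i - u| ≤ r) :
    radAvg (fun i (_ : Fin n) => c i) ≤ r * √n := by
  have hr : 0 ≤ r := (abs_nonneg _).trans (h (Classical.arbitrary ι))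
  have hle : ∀ σ : Fin n → Bool, ⨆ i, ∑ j, rsign (σ j) * c i ≤
      u * (∑ j, rsign (σ j)) + r * |∑ j, rsign (σ j)| := by
    intro σ
    refine ciSup_le fun i => ?_
    rw [← Finset.sum_mul]
    have h1 : (∑ j, rsign (σ j)) * (c i - u) ≤ |∑ j, rsign (σ j)| * r := by
      refine (le_abs_self _).trans ?_
      rw [abs_mul]
      exact mul_le_mul_of_nonneg_left (h i) (abs_nonneg _)
    linarith
  have hz : ∑ σ : Fin n → Bool, ∑ j, rsign (σ j) = 0 := by
    rw [Finset.sum_comm]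
    simp [sum_rsign]
  calc radAvg (fun i (_ : Fin n) => c i)
      ≤ (2 ^ n : ℝ)⁻¹ * ∑ σ : Fin n → Bool,
          (u * (∑ j, rsign (σ j)) + r * |∑ j, rsign (σ j)|) :=
        mul_le_mul_of_nonneg_left (Finset.sum_le_sum fun σ _ => hle σ) (by positivity)
    _ = r * ((2 ^ n : ℝ)⁻¹ * ∑ σ : Fin n → Bool, |∑ j, rsign (σ j)|) := by
        rw [Finset.sum_add_distrib, ← Finset.mul_sum, ← Finset.mul_sum, hz]
        ring
    _ ≤ r * √n := mul_le_mul_of_nonneg_left sum_abs_signed_sum_le hr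

lemma iSup_add_iSup_sub_le [Nonempty ι] {A u v : ι → ℝ}
    (hp : BddAbove (range fun i => A i + u i)) (hn : BddAbove (range fun i => A i - u i))
    (h : ∀ i i', |v i - v i'| ≤ |u i - u i'|) :
    (⨆ i, (A i + v i)) + ⨆ i, (A i - v i) ≤ (⨆ i, (A i + u i)) + ⨆ i, (A i - u i) := by
  rw [← le_sub_iff_add_le]
  refine ciSup_le fun i => ?_
  rw [le_sub_comm]
  refine ciSup_le fun i' => ?_
  have h1 := le_ciSup hp i
  have h2 := le_ciSup hn i'
  have h3 := le_ciSup hp i'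
  have h4 := le_ciSup hn i
  have h5 := (le_abs_self _).trans (h i i')
  rcases le_total (u i') (u i) with h6 | h6
  · rw [abs_of_nonneg (sub_nonneg.2 h6)] at h5
    linarith
  · rw [abs_sub_comm (u i), abs_of_nonneg (sub_nonneg.2 h6)] at h5
    linarith

/-- The Ledoux–Talagrand contraction principle. -/
lemma radAvg_le_of_contraction [Nonempty ι] {S T : ι → Fin n → ℝ} {C : ℝ}
    (hS : ∀ i j, |S i j| ≤ C) (hT : ∀ i j, |T i j| ≤ C)
    (h : ∀ i i' j, |S i j - S i' j| ≤ |T i j - T i' j|) : radAvg S ≤ radAvg T := by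
  suffices H : ∀ s : Finset (Fin n),
      radAvg (fun i j => if j ∈ s then S i j else T i j) ≤ radAvg T by
    simpa using H Finset.univ
  intro s
  induction s using Finset.induction_on with
  | empty => simp
  | insert k s hk ih =>
    refine le_trans ?_ ih
    unfold radAvg
    refine mul_le_mul_of_nonneg_left ?_ (by positivity)
    set G : (Fin n → Bool) → ℝ := fun σ =>
      ⨆ i, ∑ j, rsign (σ j) * (if j ∈ insert k s then S i j else T i j) with hG
    set H : (Fin n → Bool) → ℝ := fun σ =>
      ⨆ i, ∑ j, rsign (σ j) * (if j ∈ s then S i j else T i j) with hH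
    have key : ∀ σ, G σ + G (Function.update σ k (!σ k)) ≤
        H σ + H (Function.update σ k (!σ k)) := by
      intro σ
      set A : ι → ℝ := fun i => ∑ j ∈ Finset.univ.erase k,
        rsign (σ j) * (if j ∈ s then S i j else T i j) with hA
      have split : ∀ (τ : Fin n → Bool) (f : Fin n → ℝ),
          ∑ j, rsign (τ j) * f j = ∑ j ∈ Finset.univ.erase k, rsign (τ j) * f j +
            rsign (τ k) * f k := fun τ f =>
        (Finset.sum_erase_add _ _ (Finset.mem_univ k)).symm
      have e1 : ∀ i, ∑ j, rsign (σ j) * (if j ∈ insert k s then S i j else T i j) =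
          A i + rsign (σ k) * S i k := by
        intro i
        rw [split, if_pos (Finset.mem_insert_self _ _)]
        congr 1
        refine Finset.sum_congr rfl fun j hj => ?_
        simp [Finset.ne_of_mem_erase hj]
      have e2 : ∀ i, ∑ j, rsign (Function.update σ k (!σ k) j) *
          (if j ∈ insert k s then S i j else T i j) = A i - rsign (σ k) * S i k := by
        intro i
        rw [split, if_pos (Finset.mem_insert_self _ _), Function.update_self, rsign_not, neg_mul,
          ← sub_eq_add_neg]
        congr 1
        refine Finset.sum_congr rfl fun j hj => ?_
        simp [Finset.ne_of_mem_erase hj]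
      have e3 : ∀ i, ∑ j, rsign (σ j) * (if j ∈ s then S i j else T i j) =
          A i + rsign (σ k) * T i k := by
        intro i
        rw [split, if_neg hk]
      have e4 : ∀ i, ∑ j, rsign (Function.update σ k (!σ k) j) *
          (if j ∈ s then S i j else T i j) = A i - rsign (σ k) * T i k := by
        intro i
        rw [split, if_neg hk, Function.update_self, rsign_not, neg_mul, ← sub_eq_add_neg]
        congr 1
        refine Finset.sum_congr rfl fun j hj => ?_
        simp [Finset.ne_of_mem_erase hj]
      have hb : ∀ i j, |if j ∈ s then S i j else T i j| ≤ C := by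
        intro i j
        split_ifs
        · exact hS i j
        · exact hT i j
      have b3 := bddAbove_signed_sum hb σ
      have b4 := bddAbove_signed_sum hb (Function.update σ k (!σ k))
      simp only [e3] at b3
      simp only [e4] at b4
      simp only [hG, hH, e1, e2, e3, e4]
      refine iSup_add_iSup_sub_le b3 b4 fun i i' => ?_
      rw [← mul_sub, ← mul_sub, abs_mul, abs_mul, abs_rsign, one_mul, one_mul]
      exact h i i' k
    have hsum := Finset.sum_le_sum fun σ (_ : σ ∈ Finset.univ) => key σ
    rw [Finset.sum_add_distrib, Finset.sum_add_distrib, sum_flip, sum_flip] at hsum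
    linarith

end RademacherAverage

section SeqDense

variable {Y : Type*}

/-- A sequence in `Ψ` such that every sequentially closed (for pointwise convergence) property
of members of `Ψ` holds on `Ψ` as soon as it holds along the sequence. -/
def SeqDense (ψ : ℕ → Y → ℝ) (Ψ : Set (Y → ℝ)) : Prop :=
  (∀ k, ψ k ∈ Ψ) ∧ ∀ A : Set (Y → ℝ),
    (∀ (s : ℕ → Y → ℝ) (g : Y → ℝ), (∀ j, s j ∈ A) → (∀ j, s j ∈ Ψ) → g ∈ Ψ →
      (∀ y, Tendsto (fun j => s j y) atTop (𝓝 (g y))) → g ∈ A) →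
    (∀ k, ψ k ∈ A) → Ψ ⊆ A

lemma PtwiseDenseCount.exists_seqDense {Ψ : Set (Y → ℝ)} (h : PtwiseDenseCount Ψ)
    (hne : Ψ.Nonempty) : ∃ ψ, SeqDense ψ Ψ := by
  obtain ⟨Γ₀, hsub, hcount, hd⟩ := h
  have hne₀ : Γ₀.Nonempty := by
    obtain ⟨g, hg⟩ := hne
    obtain ⟨s, hs, -⟩ := hd g hg
    exact ⟨s 0, hs 0⟩
  obtain ⟨ψ, rfl⟩ := hcount.exists_eq_range hne₀
  refine ⟨ψ, fun k => hsub ⟨k, rfl⟩, fun A hA hψ g hg => ?_⟩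
  obtain ⟨s, hs, hlim⟩ := hd g hg
  refine hA s g (fun j => ?_) (fun j => hsub (hs j)) hg hlim
  obtain ⟨k, hk⟩ := hs j
  exact hk ▸ hψ k

lemma SeqDense.exists_comp {X Θ : Type*} [TopologicalSpace X] [MetricSpace Θ]
    [TopologicalSpace.SeparableSpace Θ] [Nonempty Θ] {Ψ : Set (X → ℝ)} {ψ : ℕ → X → ℝ}
    (hψ : SeqDense ψ Ψ) (hcont : ∀ h ∈ Ψ, Continuous h) {Φ : Θ → Y → X}
    (hΦ : ∀ y, Continuous fun θ => Φ θ y) :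
    ∃ φ, SeqDense φ {g : Y → ℝ | ∃ h ∈ Ψ, ∃ θ : Θ, g = fun y => h (Φ θ y)} := by
  set d := TopologicalSpace.denseSeq Θ
  refine ⟨fun k y => ψ k.unpair.1 (Φ (d k.unpair.2) y),
    fun k => ⟨_, hψ.1 _, _, rfl⟩, fun A hA hk => ?_⟩
  have hk' : ∀ i j, (fun y => ψ i (Φ (d j) y)) ∈ A := by
    intro i j
    simpa using hk (Nat.pair i j)
  have h1 : ∀ j, Ψ ⊆ {h | (fun y => h (Φ (d j) y)) ∈ A} := fun j =>
    hψ.2 _ (fun s g hs hsΨ hg hlim => hA (fun i y => s i (Φ (d j) y)) _ hs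
      (fun i => ⟨_, hsΨ i, _, rfl⟩) ⟨_, hg, _, rfl⟩ fun y => hlim _) fun i => hk' i j
  rintro g ⟨h, hh, θ, rfl⟩
  obtain ⟨u, hu, hlim⟩ := mem_closure_iff_seq_limit.1 (TopologicalSpace.denseRange_denseSeq Θ θ)
  choose i hi using hu
  refine hA (fun j y => h (Φ (u j) y)) _ (fun j => ?_) (fun j => ⟨h, hh, u j, rfl⟩)
    ⟨h, hh, θ, rfl⟩ fun y => ?_
  · have := h1 (i j) hh
    rw [← hi j]
    exact this
  · exact (((hcont h hh).comp (hΦ y)).tendsto θ).comp hlim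

lemma SeqDense.le_of_forall_le {ψ : ℕ → Y → ℝ} {Ψ : Set (Y → ℝ)} (hψ : SeqDense ψ Ψ)
    {W : (Y → ℝ) → ℝ} {c : ℝ}
    (hW : ∀ (s : ℕ → Y → ℝ) (g : Y → ℝ), (∀ j, s j ∈ Ψ) → g ∈ Ψ →
      (∀ y, Tendsto (fun j => s j y) atTop (𝓝 (g y))) →
      Tendsto (fun j => W (s j)) atTop (𝓝 (W g)))
    (h : ∀ k, W (ψ k) ≤ c) {g : Y → ℝ} (hg : g ∈ Ψ) : W g ≤ c :=
  hψ.2 {g | W g ≤ c} (fun s g hs hsΨ hg hlim => le_of_tendsto' (hW s g hsΨ hg hlim) hs) h hg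

lemma SeqDense.empRad_eq {ψ : ℕ → Y → ℝ} {Ψ : Set (Y → ℝ)} (hψ : SeqDense ψ Ψ) {C : ℝ}
    (hb : ∀ g ∈ Ψ, ∀ y, |g y| ≤ C) {n : ℕ} (y : Fin n → Y) :
    empRad Ψ n y = (n : ℝ)⁻¹ * radAvg fun k j => ψ k (y j) := by
  have key : ∀ σ : Fin n → Bool,
      sSup {r : ℝ | ∃ g ∈ Ψ, r = (n : ℝ)⁻¹ * ∑ i, (if σ i then 1 else -1) * g (y i)} =
        (n : ℝ)⁻¹ * ⨆ k, ∑ j, rsign (σ j) * ψ k (y j) := by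
    intro σ
    rw [Real.mul_iSup_of_nonneg (by positivity)]
    have hbdd : BddAbove (range fun k => (n : ℝ)⁻¹ * ∑ j, rsign (σ j) * ψ k (y j)) := by
      refine ⟨(n : ℝ)⁻¹ * (n * C), ?_⟩
      rintro _ ⟨k, rfl⟩
      exact mul_le_mul_of_nonneg_left
        (abs_le.1 (abs_signed_sum_le (fun j => hb _ (hψ.1 k) (y j)) σ)).2 (by positivity)
    have hle : ∀ r ∈ {r : ℝ | ∃ g ∈ Ψ, r = (n : ℝ)⁻¹ * ∑ i, (if σ i then 1 else -1) * g (y i)},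
        r ≤ ⨆ k, (n : ℝ)⁻¹ * ∑ j, rsign (σ j) * ψ k (y j) := by
      rintro _ ⟨g, hg, rfl⟩
      refine hψ.le_of_forall_le (W := fun g => (n : ℝ)⁻¹ * ∑ i, rsign (σ i) * g (y i))
        (fun s g _ _ hlim => ?_) (fun k => le_ciSup hbdd k) hg
      exact (tendsto_finsetSum _ fun i _ => (hlim (y i)).const_mul _).const_mul _
    refine le_antisymm (csSup_le ⟨_, ψ 0, hψ.1 0, rfl⟩ hle) (ciSup_le fun k => ?_)
    exact le_csSup ⟨_, hle⟩ ⟨ψ k, hψ.1 k, rfl⟩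
  unfold empRad radAvg
  simp only [key, ← Finset.mul_sum]
  ring

end SeqDense

section Symmetrization

variable {Y ι : Type*} [MeasurableSpace Y] {n : ℕ}

lemma MeasureTheory.MeasurePreserving.integral_comp_of_measurable {Y' : Type*}
    [MeasurableSpace Y'] {μ : Measure Y} {ν : Measure Y'} {e : Y → Y'}
    (he : MeasurePreserving e μ ν) {g : Y' → ℝ} (hg : Measurable g) :
    ∫ y, g (e y) ∂μ = ∫ y, g y ∂ν := by
  rw [← he.map_eq, integral_map he.measurable.aemeasurable hg.aestronglyMeasurable]

lemma integrable_of_abs_le {μ : Measure Y} [IsFiniteMeasure μ] {g : Y → ℝ} (hg : Measurable g)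
    {C : ℝ} (h : ∀ y, |g y| ≤ C) : Integrable g μ :=
  Integrable.of_bound hg.aestronglyMeasurable C (.of_forall h)

lemma abs_iSup_le [Nonempty ι] {A : ι → ℝ} {C : ℝ} (h : ∀ i, |A i| ≤ C) : |⨆ i, A i| ≤ C := by
  obtain ⟨i⟩ := ‹Nonempty ι›
  have : Nonempty ι := ⟨i⟩
  exact abs_le.2 ⟨(abs_le.1 (h i)).1.trans
    (le_ciSup (f := A) ⟨C, by rintro _ ⟨i, rfl⟩; exact (abs_le.1 (h i)).2⟩ i),
    ciSup_le fun i => (abs_le.1 (h i)).2⟩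

lemma measurable_signed_iSup [Countable ι] {φ : ι → Y → ℝ} (hφ : ∀ i, Measurable (φ i))
    (σ : Fin n → Bool) :
    Measurable fun y : Fin n → Y => ⨆ i, ∑ j, rsign (σ j) * φ i (y j) :=
  .iSup fun i => Finset.measurable_sum _ fun j _ =>
    ((hφ i).comp (measurable_pi_apply j)).const_mul _

lemma measurable_radAvg [Countable ι] {φ : ι → Y → ℝ} (hφ : ∀ i, Measurable (φ i)) :
    Measurable fun y : Fin n → Y => radAvg fun i j => φ i (y j) :=
  (Finset.measurable_sum _ fun σ _ => measurable_signed_iSup hφ σ).const_mul _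

lemma abs_integral_sub_le {P : Measure Y} [IsProbabilityMeasure P] (hn : 0 < n) {g : Y → ℝ}
    {C : ℝ} (hC : ∀ y, |g y| ≤ C) (x : Fin n → Y) :
    |(∫ y, g y ∂P) - (n : ℝ)⁻¹ * ∑ j, g (x j)| ≤ C + C := by
  have hn' : (0 : ℝ) < n := by exact_mod_cast hn
  have h1 : |∫ y, g y ∂P| ≤ C := by
    simpa using norm_integral_le_of_norm_le_const (f := g) (μ := P) (.of_forall hC)
  have h2 : |(n : ℝ)⁻¹ * ∑ j, g (x j)| ≤ C := by
    rw [abs_mul, abs_of_nonneg (by positivity), inv_mul_le_iff₀ hn']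
    exact (Finset.abs_sum_le_sum_abs _ _).trans
      ((Finset.sum_le_sum fun j _ => hC _).trans (by simp))
  exact (abs_sub _ _).trans (add_le_add h1 h2)

/-- Symmetrization: the expected one-sided deviation of empirical means is at most twice the
Rademacher complexity. -/
lemma integral_iSup_sub_le [Countable ι] [Nonempty ι] (P : Measure Y) [IsProbabilityMeasure P]
    (hn : 0 < n)
    {φ : ι → Y → ℝ} (hφ : ∀ i, Measurable (φ i)) {C : ℝ} (hC : ∀ i y, |φ i y| ≤ C) :
    ∫ x, ⨆ i, ((∫ y, φ i y ∂P) - (n : ℝ)⁻¹ * ∑ j, φ i (x j)) ∂(Measure.pi fun _ : Fin n => P) ≤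
      2 * ((n : ℝ)⁻¹ * ∫ x, radAvg (fun i j => φ i (x j)) ∂(Measure.pi fun _ : Fin n => P)) := by
  have hn' : (0 : ℝ) < n := by exact_mod_cast hn
  set μ := Measure.pi fun _ : Fin n => P with hμ
  set R : (Fin n → Bool) → (Fin n → Y) → ℝ := fun σ x => ⨆ i, ∑ j, rsign (σ j) * φ i (x j)
    with hR
  have hRm : ∀ σ, Measurable (R σ) := measurable_signed_iSup hφ
  have hRb : ∀ σ x, |R σ x| ≤ n * C := fun σ x =>
    abs_iSup_le fun i => abs_signed_sum_le (fun j => hC i _) σ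
  have hRi : ∀ σ, Integrable (R σ) μ := fun σ => integrable_of_abs_le (hRm σ) (hRb σ)
  set S : (Fin n → Y) × (Fin n → Y) → ℝ := fun p => ⨆ i, ∑ j, (φ i (p.2 j) - φ i (p.1 j)) with hS
  have hSm : Measurable S := .iSup fun i => Finset.measurable_sum _ fun j _ =>
    ((hφ i).comp ((measurable_pi_apply j).comp measurable_snd)).sub
      ((hφ i).comp ((measurable_pi_apply j).comp measurable_fst))
  have hSb' : ∀ i (p : (Fin n → Y) × (Fin n → Y)),
      |∑ j, (φ i (p.2 j) - φ i (p.1 j))| ≤ n * (C + C) := by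
    intro i p
    refine (Finset.abs_sum_le_sum_abs _ _).trans
      ((Finset.sum_le_sum fun j _ => (?_ : _ ≤ C + C)).trans (by simp [mul_add]))
    exact (abs_sub _ _).trans (add_le_add (hC _ _) (hC _ _))
  have hSb : ∀ p, |S p| ≤ n * (C + C) := fun p => abs_iSup_le fun i => hSb' i p
  have hSi : Integrable S (μ.prod μ) := integrable_of_abs_le hSm hSb
  have hcoord : ∀ i j, ∫ x, φ i (x j) ∂μ = ∫ y, φ i y ∂P := fun i j =>
    (measurePreserving_eval (fun _ : Fin n => P) j).integral_comp_of_measurable (hφ i)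
  have hφi : ∀ i j, Integrable (fun x : Fin n → Y => φ i (x j)) μ := fun i j =>
    integrable_of_abs_le ((hφ i).comp (measurable_pi_apply j)) fun x => hC i _
  have step1 : ∫ x, ⨆ i, ((∫ y, φ i y ∂P) - (n : ℝ)⁻¹ * ∑ j, φ i (x j)) ∂μ ≤
      (n : ℝ)⁻¹ * ∫ p, S p ∂(μ.prod μ) := by
    rw [integral_prod _ hSi, ← integral_const_mul]
    refine integral_mono (integrable_of_abs_le (C := C + C) (.iSup fun i => ?_) fun x =>
      abs_iSup_le fun i => abs_integral_sub_le hn (hC i) x)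
      (hSi.integral_prod_left.const_mul _) fun x => ?_
    · exact measurable_const.sub ((Finset.measurable_sum _ fun j _ =>
        (hφ i).comp (measurable_pi_apply j)).const_mul _)
    · refine ciSup_le fun i => ?_
      have h1 : ∫ x', ∑ j, (φ i (x' j) - φ i (x j)) ∂μ =
          n * (∫ y, φ i y ∂P) - ∑ j, φ i (x j) := by
        have hi : ∀ j ∈ Finset.univ,
            Integrable (fun x' : Fin n → Y => φ i (x' j) - φ i (x j)) μ := fun j _ =>
          (hφi i j).sub (integrable_const _)
        rw [integral_finsetSum _ hi]
        simp only [integral_sub (hφi i _) (integrable_const _), hcoord]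
        simp [Finset.sum_sub_distrib]
      have h2 : ∫ x', ∑ j, (φ i (x' j) - φ i (x j)) ∂μ ≤ ∫ x', S (x, x') ∂μ := by
        refine integral_mono (integrable_finsetSum _ fun j _ =>
          (hφi i j).sub (integrable_const _)) (integrable_of_abs_le
            (hSm.comp measurable_prodMk_left) fun x' => hSb _) fun x' => ?_
        exact le_ciSup (f := fun i => ∑ j, (φ i (x' j) - φ i (x j)))
          ⟨n * (C + C), by rintro _ ⟨i, rfl⟩; exact (abs_le.1 (hSb' i (x, x'))).2⟩ i
      rw [h1] at h2
      calc (∫ y, φ i y ∂P) - (n : ℝ)⁻¹ * ∑ j, φ i (x j)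
          = (n : ℝ)⁻¹ * (n * (∫ y, φ i y ∂P) - ∑ j, φ i (x j)) := by field_simp
        _ ≤ _ := mul_le_mul_of_nonneg_left h2 (by positivity)
  have step2 : ∀ σ : Fin n → Bool,
      ∫ p, S p ∂(μ.prod μ) ≤ (∫ x, R σ x ∂μ) + ∫ x, R (fun j => !σ j) x ∂μ := by
    intro σ
    have he := measurePreserving_arrowProdEquivProdArrow Y Y (Fin n) (fun _ => P) (fun _ => P)
    have hflip := measurePreserving_pi (fun _ : Fin n => P.prod P) (fun _ => P.prod P)
      (f := fun j => if σ j then id else Prod.swap) fun j => by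
        split_ifs
        · exact .id _
        · exact Measure.measurePreserving_swap
    have hfst : MeasurePreserving Prod.fst (μ.prod μ) μ := measurePreserving_fst
    have hsnd : MeasurePreserving Prod.snd (μ.prod μ) μ := measurePreserving_snd
    have i1 : Integrable (fun p : (Fin n → Y) × (Fin n → Y) => R σ p.2) (μ.prod μ) :=
      integrable_of_abs_le ((hRm σ).comp measurable_snd) fun p => hRb _ _
    have i2 : Integrable (fun p : (Fin n → Y) × (Fin n → Y) => R (fun j => !σ j) p.1)
        (μ.prod μ) :=
      integrable_of_abs_le ((hRm _).comp measurable_fst) fun p => hRb _ _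
    have hm : Measurable fun p : (Fin n → Y) × (Fin n → Y) =>
        R σ p.2 + R (fun j => !σ j) p.1 :=
      ((hRm σ).comp measurable_snd).add ((hRm _).comp measurable_fst)
    rw [← hsnd.integral_comp_of_measurable (hRm σ), ← hfst.integral_comp_of_measurable (hRm _),
      ← integral_add i1 i2, ← he.integral_comp_of_measurable hSm,
      ← he.integral_comp_of_measurable hm,
      ← hflip.integral_comp_of_measurable (g := fun w => S (MeasurableEquiv.arrowProdEquivProdArrow
        Y Y (Fin n) w)) (hSm.comp he.measurable)]
    refine integral_mono (integrable_of_abs_le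
      ((hSm.comp he.measurable).comp hflip.measurable) fun p => hSb _)
      (integrable_of_abs_le (hm.comp he.measurable) fun p =>
        (abs_add_le _ _).trans (add_le_add (hRb _ _) (hRb _ _))) fun w => ?_
    refine ciSup_le fun i => ?_
    have e : ∀ j, φ i ((if σ j then id else Prod.swap) (w j)).2 -
        φ i ((if σ j then id else Prod.swap) (w j)).1 =
        rsign (σ j) * φ i (w j).2 + rsign (!σ j) * φ i (w j).1 := by
      intro j
      cases h : σ j <;> simp [rsign] <;> ring
    calc _ = ∑ j, (rsign (σ j) * φ i (w j).2 + rsign (!σ j) * φ i (w j).1) :=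
          Finset.sum_congr rfl fun j _ => e j
      _ = (∑ j, rsign (σ j) * φ i (w j).2) + ∑ j, rsign (!σ j) * φ i (w j).1 :=
          Finset.sum_add_distrib
      _ ≤ _ := add_le_add
          (le_ciSup (bddAbove_signed_sum (T := fun i j => φ i (w j).2) (fun i j => hC i _) σ) i)
          (le_ciSup (bddAbove_signed_sum (T := fun i j => φ i (w j).1) (fun i j => hC i _) _) i)
  have hrad : ∫ x, radAvg (fun i j => φ i (x j)) ∂μ =
      (2 ^ n : ℝ)⁻¹ * ∑ σ : Fin n → Bool, ∫ x, R σ x ∂μ := by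
    simp only [radAvg]
    rw [integral_const_mul, integral_finsetSum _ fun σ _ => hRi σ]
  refine step1.trans ?_
  rw [mul_left_comm]
  refine mul_le_mul_of_nonneg_left ?_ (by positivity)
  rw [hrad]
  have := Finset.sum_le_sum fun σ (_ : σ ∈ Finset.univ) => step2 σ
  rw [Finset.sum_add_distrib, sum_flip_all fun σ => ∫ x, R σ x ∂μ] at this
  simp only [Finset.sum_const, Finset.card_univ, Fintype.card_pi, Fintype.card_bool,
    Finset.prod_const, Fintype.card_fin, nsmul_eq_mul] at this
  push_cast at this
  rw [mul_left_comm, ← div_eq_inv_mul, le_div_iff₀ (by positivity)]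
  linarith

end Symmetrization

section BoundedDifferences

variable {Y : Type*} [MeasurableSpace Y]

lemma integral_exp_mul_le_of_le_add {P : Measure Y} [IsProbabilityMeasure P] {g : Y → ℝ}
    (hg : Measurable g) {c : ℝ} (h : ∀ y y', g y ≤ g y' + c) (t : ℝ) :
    ∫ y, Real.exp (t * g y) ∂P ≤ Real.exp (t * (∫ y, g y ∂P) + c ^ 2 * t ^ 2 / 8) := by
  have hne : Nonempty Y := nonempty_of_isProbabilityMeasure P
  obtain ⟨y₀⟩ := hne
  have : Nonempty Y := ⟨y₀⟩
  have hbdd : BddBelow (range g) := ⟨g y₀ - c, by rintro _ ⟨y, rfl⟩; linarith [h y₀ y]⟩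
  have hmem : ∀ y, g y ∈ Icc (⨅ y, g y) ((⨅ y, g y) + c) := fun y =>
    ⟨ciInf_le hbdd y, by
      rw [← sub_le_iff_le_add]
      exact le_ciInf fun y' => by linarith [h y y']⟩
  have hsub := ProbabilityTheory.hasSubgaussianMGF_of_mem_Icc (μ := P) hg.aemeasurable
    (.of_forall hmem)
  have hle := hsub.mgf_le t
  have he : ∀ y, Real.exp (t * g y) =
      Real.exp (t * ∫ y, g y ∂P) * Real.exp (t * (g y - ∫ y, g y ∂P)) := by
    intro y
    rw [← Real.exp_add]
    congr 1
    ring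
  simp only [he]
  rw [integral_const_mul, Real.exp_add]
  refine mul_le_mul_of_nonneg_left (hle.trans (Real.exp_le_exp.2 (le_of_eq ?_)))
    (Real.exp_pos _).le
  simp [div_pow]
  ring

/-- The bounded differences inequality of McDiarmid in the form of a bound on the moment generating
function. -/
lemma integral_exp_mul_le_of_update_le {P : Measure Y} [IsProbabilityMeasure P] {n : ℕ}
    {G : (Fin n → Y) → ℝ} (hG : Measurable G) {C : ℝ} (hC : ∀ x, |G x| ≤ C) {c : ℝ}
    (h : ∀ x j y, G (Function.update x j y) ≤ G x + c) (t : ℝ) :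
    ∫ x, Real.exp (t * G x) ∂(Measure.pi fun _ : Fin n => P) ≤
      Real.exp (t * (∫ x, G x ∂(Measure.pi fun _ : Fin n => P)) + n * (c ^ 2 * t ^ 2 / 8)) := by
  induction n with
  | zero =>
    rw [Measure.pi_of_empty, integral_dirac, integral_dirac]
    simp
  | succ n ih =>
    set μ := Measure.pi fun _ : Fin n => P
    set e := MeasurableEquiv.piFinSuccAbove (fun _ : Fin (n + 1) => Y) 0
    have he : MeasurePreserving e.symm (P.prod μ) (Measure.pi fun _ : Fin (n + 1) => P) :=
      (measurePreserving_piFinSuccAbove (fun _ : Fin (n + 1) => P) 0).symm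
    have hcons : ∀ y x, e.symm (y, x) = Fin.cons y x := by
      intro y x
      ext j
      refine Fin.cases ?_ (fun j => ?_) j <;> simp [e, MeasurableEquiv.piFinSuccAbove]
    have hexp : Measurable fun x => Real.exp (t * G x) := (hG.const_mul t).exp
    have hGe : Measurable fun p => G (e.symm p) := hG.comp e.symm.measurable
    have hi : Integrable (fun p => G (e.symm p)) (P.prod μ) :=
      integrable_of_abs_le hGe fun p => hC _
    have hexpb : ∀ x, |Real.exp (t * G x)| ≤ Real.exp (|t| * C) := by
      intro x
      rw [abs_of_pos (Real.exp_pos _), Real.exp_le_exp]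
      refine (le_abs_self _).trans ?_
      rw [abs_mul]
      exact mul_le_mul_of_nonneg_left (hC x) (abs_nonneg t)
    have hie : Integrable (fun p => Real.exp (t * G (e.symm p))) (P.prod μ) :=
      integrable_of_abs_le (hexp.comp e.symm.measurable) fun p => hexpb _
    have hsec : ∀ y, Measurable fun x => G (e.symm (y, x)) := fun y =>
      hGe.comp measurable_prodMk_left
    set g : Y → ℝ := fun y => ∫ x, G (e.symm (y, x)) ∂μ with hg
    have hgm : Measurable g := (hGe.stronglyMeasurable.integral_prod_right).measurable
    have hgb : ∀ y, |g y| ≤ C := fun y => by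
      simpa using norm_integral_le_of_norm_le_const (μ := μ)
        (f := fun x => G (e.symm (y, x))) (.of_forall fun x => hC _)
    have hgd : ∀ y y', g y ≤ g y' + c := by
      intro y y'
      have h1 : ∀ x, G (e.symm (y, x)) ≤ G (e.symm (y', x)) + c := by
        intro x
        have := h (e.symm (y', x)) 0 y
        rwa [hcons, Fin.update_cons_zero, ← hcons, ← hcons] at this
      have i1 : ∀ y, Integrable (fun x => G (e.symm (y, x))) μ := fun y =>
        integrable_of_abs_le (hsec y) fun x => hC _
      have := integral_mono (i1 y) ((i1 y').add (integrable_const c)) h1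
      rw [integral_add' (i1 y') (integrable_const c)] at this
      simpa using this
    have inner : ∀ y, ∫ x, Real.exp (t * G (e.symm (y, x))) ∂μ ≤
        Real.exp (t * g y) * Real.exp (n * (c ^ 2 * t ^ 2 / 8)) := by
      intro y
      rw [← Real.exp_add]
      refine ih (hsec y) (fun x => hC _) fun x j z => ?_
      have := h (e.symm (y, x)) j.succ z
      rwa [hcons, ← Fin.cons_update, ← hcons, ← hcons] at this
    have hgi : Integrable (fun y => Real.exp (t * g y)) P := by
      refine integrable_of_abs_le (hgm.const_mul t).exp (C := Real.exp (|t| * C)) fun y => ?_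
      rw [abs_of_pos (Real.exp_pos _), Real.exp_le_exp]
      refine (le_abs_self _).trans ?_
      rw [abs_mul]
      exact mul_le_mul_of_nonneg_left (hgb y) (abs_nonneg t)
    rw [← he.integral_comp_of_measurable hexp, ← he.integral_comp_of_measurable hG,
      integral_prod _ hie, integral_prod _ hi]
    calc _ ≤ ∫ y, Real.exp (t * g y) * Real.exp (n * (c ^ 2 * t ^ 2 / 8)) ∂P :=
          integral_mono hie.integral_prod_left (hgi.mul_const _) inner
      _ ≤ Real.exp (t * (∫ y, g y ∂P) + c ^ 2 * t ^ 2 / 8) *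
          Real.exp (n * (c ^ 2 * t ^ 2 / 8)) := by
        rw [integral_mul_const]
        exact mul_le_mul_of_nonneg_right (integral_exp_mul_le_of_le_add hgm hgd t)
          (Real.exp_pos _).le
      _ = _ := by
        rw [← Real.exp_add]
        congr 1
        push_cast
        ring

/-- A tail bound for the sum of two functions with bounded differences of independent
samples. -/
lemma measureReal_ge_le_of_update_le {Y' : Type*} [MeasurableSpace Y'] {P : Measure Y}
    [IsProbabilityMeasure P] {P' : Measure Y'} [IsProbabilityMeasure P'] {n m : ℕ}
    {G : (Fin n → Y) → ℝ} {H : (Fin m → Y') → ℝ} (hG : Measurable G) (hH : Measurable H)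
    {C D : ℝ} (hC : ∀ x, |G x| ≤ C) (hD : ∀ x, |H x| ≤ D) {c d : ℝ}
    (h : ∀ x j y, G (Function.update x j y) ≤ G x + c)
    (h' : ∀ x j y, H (Function.update x j y) ≤ H x + d) {ε : ℝ} (hε : 0 ≤ ε) :
    ((Measure.pi fun _ : Fin n => P).prod (Measure.pi fun _ : Fin m => P')).real
      {p | ε + (∫ x, G x ∂(Measure.pi fun _ : Fin n => P)) +
        (∫ x, H x ∂(Measure.pi fun _ : Fin m => P')) ≤ G p.1 + H p.2} ≤
      Real.exp (-ε ^ 2 / (2 * ((n * c ^ 2 + m * d ^ 2) / 4))) := by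
  set μ := Measure.pi fun _ : Fin n => P
  set ν := Measure.pi fun _ : Fin m => P'
  set EG := ∫ x, G x ∂μ
  set EH := ∫ x, H x ∂ν
  have hm : Measurable fun p : (Fin n → Y) × (Fin m → Y') => (G p.1 - EG) + (H p.2 - EH) :=
    ((hG.comp measurable_fst).sub_const _).add ((hH.comp measurable_snd).sub_const _)
  have hsub : ProbabilityTheory.HasSubgaussianMGF
      (fun p : (Fin n → Y) × (Fin m → Y') => (G p.1 - EG) + (H p.2 - EH))
      ((n * c ^ 2 + m * d ^ 2) / 4 : ℝ).toNNReal (μ.prod ν) := by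
    refine ⟨fun t => ?_, fun t => ?_⟩
    · refine integrable_of_abs_le (hm.const_mul t).exp
        (C := Real.exp (|t| * (C + |EG| + (D + |EH|)))) fun p => ?_
      rw [abs_of_pos (Real.exp_pos _), Real.exp_le_exp]
      refine (le_abs_self _).trans ?_
      rw [abs_mul]
      refine mul_le_mul_of_nonneg_left ((abs_add_le _ _).trans (add_le_add
        ((abs_sub _ _).trans ?_) ((abs_sub _ _).trans ?_))) (abs_nonneg t)
      · exact add_le_add_left (hC _) _
      · exact add_le_add_left (hD _) _
    · have he : ∀ p : (Fin n → Y) × (Fin m → Y'),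
          Real.exp (t * ((G p.1 - EG) + (H p.2 - EH))) =
          Real.exp (-(t * (EG + EH))) * (Real.exp (t * G p.1) * Real.exp (t * H p.2)) := by
        intro p
        rw [← Real.exp_add, ← Real.exp_add]
        congr 1
        ring
      unfold ProbabilityTheory.mgf
      simp only [he]
      rw [integral_const_mul, integral_prod_mul (fun x => Real.exp (t * G x))
        (fun x => Real.exp (t * H x))]
      calc _ ≤ Real.exp (-(t * (EG + EH))) * (Real.exp (t * EG + n * (c ^ 2 * t ^ 2 / 8)) *
            Real.exp (t * EH + m * (d ^ 2 * t ^ 2 / 8))) :=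
          mul_le_mul_of_nonneg_left (mul_le_mul (integral_exp_mul_le_of_update_le hG hC h t)
            (integral_exp_mul_le_of_update_le hH hD h' t)
            (integral_nonneg fun _ => (Real.exp_pos _).le) (Real.exp_pos _).le)
            (Real.exp_pos _).le
        _ = _ := by
          rw [← Real.exp_add, ← Real.exp_add, Real.coe_toNNReal _ (by positivity)]
          congr 1
          ring
  have := hsub.measure_ge_le hε
  rw [Real.coe_toNNReal _ (by positivity)] at this
  refine le_of_eq_of_le ?_ this
  congr 1
  ext p
  simp only [mem_ofPred_eq]
  constructor <;> intro h <;> linarith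

end BoundedDifferences

section Deviation

variable {F : ℝ → ℝ} {α β z₀ L : ℝ} {Y : Type*} [MeasurableSpace Y] {ψ : ℕ → Y → ℝ}
  (hF : IsLegendre F z₀ (β - α) L) (hψ : ∀ k, Measurable (ψ k)) (hψb : ∀ k y, ψ k y ∈ Icc α β)

include hF hψb in
omit [MeasurableSpace Y] in
lemma IsLegendre.abs_comp_sub_le (k : ℕ) (y : Y) {ν : ℝ} (hν : ν ∈ Icc (α - z₀) (β - z₀)) :
    |F (ψ k y - ν)| ≤ |z₀| + L * (β - α) := by
  have h := hF.lip _ (sub_mem_Icc (hψb k y) hν) z₀ ⟨by linarith [hF.pos], by linarith [hF.pos]⟩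
  rw [hF.map_zero] at h
  have h1 : |ψ k y - ν - z₀| ≤ β - α := by
    have := sub_mem_Icc (hψb k y) hν
    rw [abs_le]
    constructor <;> linarith [this.1, this.2]
  have h2 := mul_le_mul_of_nonneg_left h1 hF.nonneg
  have h3 : |F (ψ k y - ν)| ≤ |F (ψ k y - ν) - z₀| + |z₀| := by
    simpa using abs_add_le (F (ψ k y - ν) - z₀) z₀
  linarith

/-- The largest deviation, with sign `s`, between the values of `lam` at `P` and at an empirical
measure along the sequence `ψ`. -/
noncomputable def lamDev (F : ℝ → ℝ) (α β z₀ : ℝ) (P : Measure Y) (ψ : ℕ → Y → ℝ) (s : ℝ) (m : ℕ)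
    (y : Fin m → Y) : ℝ :=
  ⨆ k, s * (lam F α β z₀ P (ψ k) - lam F α β z₀ (empMeas m y) (ψ k))

variable {P : Measure Y} [IsProbabilityMeasure P] {m : ℕ} {s : ℝ}

include hF hψ hψb

lemma IsLegendre.abs_mul_lam_sub_le (hm : 0 < m) (hs : |s| = 1) (k : ℕ) (y : Fin m → Y) :
    |s * (lam F α β z₀ P (ψ k) - lam F α β z₀ (empMeas m y) (ψ k))| ≤ β - α := by
  have := isProbabilityMeasure_empMeas hm y
  have h1 := hF.lam_mem_Icc (P := P) (hψ k) (hψb k)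
  have h2 := hF.lam_mem_Icc (P := empMeas m y) (hψ k) (hψb k)
  rw [abs_mul, hs, one_mul, abs_le]
  constructor <;> linarith [h1.1, h1.2, h2.1, h2.2]

lemma IsLegendre.abs_lamDev_le (hm : 0 < m) (hs : |s| = 1) (y : Fin m → Y) :
    |lamDev F α β z₀ P ψ s m y| ≤ β - α :=
  abs_iSup_le fun k => hF.abs_mul_lam_sub_le hψ hψb hm hs k y

lemma IsLegendre.le_lamDev (hm : 0 < m) (hs : |s| = 1) (k : ℕ) (y : Fin m → Y) :
    s * (lam F α β z₀ P (ψ k) - lam F α β z₀ (empMeas m y) (ψ k)) ≤ lamDev F α β z₀ P ψ s m y :=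
  le_ciSup (f := fun k => s * (lam F α β z₀ P (ψ k) - lam F α β z₀ (empMeas m y) (ψ k)))
    ⟨β - α, by rintro _ ⟨k, rfl⟩; exact (abs_le.1 (hF.abs_mul_lam_sub_le hψ hψb hm hs k y)).2⟩ k

omit [IsProbabilityMeasure P] in
lemma IsLegendre.measurable_lamDev (hm : 0 < m) :
    Measurable fun y : Fin m → Y => lamDev F α β z₀ P ψ s m y :=
  .iSup fun k => ((hF.measurable_lam_empMeas (hψ k) (hψb k) hm).const_sub _).const_mul _

lemma IsLegendre.lamDev_update_le (hm : 0 < m) (hs : |s| = 1) (y : Fin m → Y) (j : Fin m) (v : Y)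
    {z : ℝ} (hz : z ∈ Icc (z₀ - (β - α)) z₀) :
    lamDev F α β z₀ P ψ s m (Function.update y j v) ≤ lamDev F α β z₀ P ψ s m y +
      (-z + (((m : ℝ) - 1) / m) * F z + (1 / (m : ℝ)) * F (β - α + z)) := by
  refine ciSup_le fun k => ?_
  have h1 := hF.le_lamDev (P := P) hψ hψb hm hs k y
  have h2 := hF.lam_empMeas_update_le (hψ k) (hψb k) hm y j v hz
  have h3 := hF.lam_empMeas_update_le (hψ k) (hψb k) hm (Function.update y j v) j (y j) hz
  rw [Function.update_idem, Function.update_eq_self] at h3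
  rcases eq_or_eq_neg_of_abs_eq hs with rfl | rfl <;> linarith

/-- The expected deviation is controlled by any bound on the Rademacher averages of the integrands,
up to constants depending only on the parameter `ν`. -/
lemma IsLegendre.integral_lamDev_le (hm : 0 < m) (hs : |s| = 1)
    {c : ℕ → Icc (α - z₀) (β - z₀)} (hc : DenseRange c) {r : ℕ → ℝ} {B : ℝ} (hr : ∀ q, |r q| ≤ B)
    {A D : ℝ} (hA : ∀ y : Fin m → Y,
      radAvg (fun (i : ℕ × ℕ) j => F (ψ i.1 (y j) - c i.2) + r i.2) ≤
        A * radAvg (fun k j => ψ k (y j)) + D * √m) :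
    ∫ y, lamDev F α β z₀ P ψ s m y ∂(Measure.pi fun _ : Fin m => P) ≤
      2 * (A * ((m : ℝ)⁻¹ *
        ∫ y, radAvg (fun k j => ψ k (y j)) ∂(Measure.pi fun _ : Fin m => P)) + D / √m) := by
  have hm' : (0 : ℝ) < m := by exact_mod_cast hm
  set μ := Measure.pi fun _ : Fin m => P
  set φ : ℕ × ℕ → Y → ℝ := fun i y => s * (F (ψ i.1 y - c i.2) + r i.2) with hφ_def
  have hφ : ∀ i, Measurable (φ i) := fun i =>
    ((hF.measurable_comp (hψ i.1) _).add_const _).const_mul _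
  set C := |z₀| + L * (β - α) + B
  have hφb' : ∀ (i : ℕ × ℕ) y, |F (ψ i.1 y - c i.2) + r i.2| ≤ C := fun i y =>
    (abs_add_le _ _).trans (add_le_add (hF.abs_comp_sub_le hψb _ _ (c _).2) (hr _))
  have hφb : ∀ i y, |φ i y| ≤ C := fun i y => by
    rw [abs_mul, hs, one_mul]
    exact hφb' i y
  have hrad : ∀ y : Fin m → Y, radAvg (fun i j => φ i (y j)) ≤
      A * radAvg (fun k j => ψ k (y j)) + D * √m := by
    intro y
    refine le_of_eq_of_le ?_ (hA y)
    rcases eq_or_eq_neg_of_abs_eq hs with rfl | rfl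
    · simp [hφ_def]
    · simp only [hφ_def, neg_one_mul]
      exact radAvg_neg _
  have hdev : ∀ i (y : Fin m → Y), (∫ v, φ i v ∂P) - (m : ℝ)⁻¹ * ∑ j, φ i (y j) =
      s * ((c i.2 + ∫ v, F (ψ i.1 v - c i.2) ∂P) -
        (c i.2 + (m : ℝ)⁻¹ * ∑ j, F (ψ i.1 (y j) - c i.2))) := by
    intro i y
    simp only [hφ_def]
    rw [integral_const_mul, integral_add (hF.integrable_comp (hψ _) (hψb _) (c _).2)
      (integrable_const _), ← Finset.mul_sum, Finset.sum_add_distrib]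
    simp
    field_simp
    ring
  have hbdd : ∀ y : Fin m → Y, BddAbove (range fun i : ℕ × ℕ =>
      (∫ v, φ i v ∂P) - (m : ℝ)⁻¹ * ∑ j, φ i (y j)) := by
    intro y
    refine ⟨C + C, ?_⟩
    rintro _ ⟨i, rfl⟩
    exact (le_abs_self _).trans (abs_integral_sub_le hm (hφb i) y)
  have hpt : ∀ y : Fin m → Y, lamDev F α β z₀ P ψ s m y ≤
      ⨆ i, ((∫ v, φ i v ∂P) - (m : ℝ)⁻¹ * ∑ j, φ i (y j)) := by
    intro y
    have := isProbabilityMeasure_empMeas hm y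
    refine ciSup_le fun k => ?_
    have hle := fun q => le_ciSup (hbdd y) (k, q)
    simp only [hdev] at hle ⊢
    set S := ⨆ i : ℕ × ℕ, s * ((c i.2 + ∫ v, F (ψ i.1 v - c i.2) ∂P) -
        (c i.2 + (m : ℝ)⁻¹ * ∑ j, F (ψ i.1 (y j) - c i.2)))
    have hP := fun q => hF.lam_le (P := P) (hψ k) (hψb k) (c q).2
    have hE := fun q => hF.lam_le (P := empMeas m y) (hψ k) (hψb k) (c q).2
    simp only [integral_empMeas y (hF.measurable_comp (hψ k) _)] at hE
    rcases eq_or_eq_neg_of_abs_eq hs with rfl | rfl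
    · have : lam F α β z₀ P (ψ k) - S ≤ lam F α β z₀ (empMeas m y) (ψ k) := by
        rw [hF.lam_eq_iInf_nat (P := empMeas m y) (hψ k) (hψb k) hc]
        refine le_ciInf fun q => ?_
        rw [integral_empMeas y (hF.measurable_comp (hψ k) _)]
        linarith [hP q, hle q]
      linarith
    · have : lam F α β z₀ (empMeas m y) (ψ k) - S ≤ lam F α β z₀ P (ψ k) := by
        rw [hF.lam_eq_iInf_nat (P := P) (hψ k) (hψb k) hc]
        refine le_ciInf fun q => ?_
        linarith [hE q, hle q]
      linarith
  have hψC : ∀ k y, |ψ k y| ≤ max |α| |β| := fun k y =>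
    abs_le_max_abs_abs (hψb k y).1 (hψb k y).2
  have hψi : Integrable (fun y : Fin m → Y => radAvg fun k j => ψ k (y j)) μ :=
    integrable_of_abs_le (measurable_radAvg hψ) fun y => abs_radAvg_le fun k j => hψC k _
  calc ∫ y, lamDev F α β z₀ P ψ s m y ∂μ
      ≤ ∫ y, ⨆ i, ((∫ v, φ i v ∂P) - (m : ℝ)⁻¹ * ∑ j, φ i (y j)) ∂μ := by
        refine integral_mono (integrable_of_abs_le (hF.measurable_lamDev hψ hψb hm)
          (hF.abs_lamDev_le hψ hψb hm hs)) ?_ hpt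
        refine integrable_of_abs_le (C := C + C) (.iSup fun i => measurable_const.sub
          ((Finset.measurable_sum _ fun j _ => (hφ i).comp (measurable_pi_apply j)).const_mul _))
          fun y => abs_iSup_le fun i => abs_integral_sub_le hm (hφb i) y
    _ ≤ 2 * ((m : ℝ)⁻¹ * ∫ y, radAvg (fun i j => φ i (y j)) ∂μ) :=
        integral_iSup_sub_le P hm hφ hφb
    _ ≤ 2 * ((m : ℝ)⁻¹ * ∫ y, (A * radAvg (fun k j => ψ k (y j)) + D * √m) ∂μ) := by
        refine mul_le_mul_of_nonneg_left (mul_le_mul_of_nonneg_left (integral_mono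
          (integrable_of_abs_le (measurable_radAvg hφ) fun y => abs_radAvg_le fun i j => hφb i _)
          ((hψi.const_mul A).add (integrable_const _)) hrad) (by positivity)) (by norm_num)
    _ = _ := by
        rw [integral_add (hψi.const_mul A) (integrable_const _), integral_const_mul]
        simp
        have h3 : (m : ℝ)⁻¹ * √m = (√m)⁻¹ := by
          rw [← Real.mul_self_sqrt hm'.le]
          have := (Real.sqrt_pos.2 hm').ne'
          field_simp
          simp
        rw [mul_add, mul_left_comm _ D, h3]
        ring

end Deviation

section Expectation

variable {α β : ℝ} {Y : Type*} [MeasurableSpace Y]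

lemma SeqDense.rad_eq {ψ : ℕ → Y → ℝ} {Ψ : Set (Y → ℝ)} (hψ : SeqDense ψ Ψ) {C : ℝ}
    (hb : ∀ g ∈ Ψ, ∀ y, |g y| ≤ C) (P : Measure Y) (n : ℕ) :
    rad Ψ P n = (n : ℝ)⁻¹ *
      ∫ y, radAvg (fun k j => ψ k (y j)) ∂(Measure.pi fun _ : Fin n => P) := by
  unfold rad
  simp only [hψ.empRad_eq hb]
  exact integral_const_mul _ _

omit [MeasurableSpace Y] in
lemma radAvg_sub_le {ψ : ℕ → Y → ℝ} (hψb : ∀ k y, ψ k y ∈ Icc α β) {z₀ : ℝ}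
    (c : ℕ → Icc (α - z₀) (β - z₀)) {m : ℕ} (y : Fin m → Y) :
    radAvg (fun (i : ℕ × ℕ) j => ψ i.1 (y j) - c i.2) ≤
      radAvg (fun k j => ψ k (y j)) + (β - α) / 2 * √m := by
  have hc : ∀ q, |-(c q : ℝ) - (z₀ - (α + β) / 2)| ≤ (β - α) / 2 := fun q => by
    rw [abs_le]
    constructor <;> linarith [(c q).2.1, (c q).2.2]
  refine (radAvg_le_add (S := fun k j => ψ k (y j)) (T := fun q _ => -(c q : ℝ))
    (C := max |α| |β|) (D := max |z₀ - β| |z₀ - α|)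
    (fun k j => abs_le_max_abs_abs (hψb k _).1 (hψb k _).2) (fun q _ => abs_le_max_abs_abs
      (by linarith [(c q).2.2]) (by linarith [(c q).2.1])) Prod.fst Prod.snd fun i j =>
        sub_eq_add_neg _ _).trans ?_
  exact add_le_add_right (radAvg_const_le hc) _

omit [MeasurableSpace Y] in
lemma radAvg_comp_sub_le {ψ : ℕ → Y → ℝ} (hψb : ∀ k y, ψ k y ∈ Icc α β) {z₀ : ℝ}
    (c : ℕ → Icc (α - z₀) (β - z₀)) {g : ℝ → ℝ} {κ : ℝ} (hκ : 0 ≤ κ)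
    (hg : ∀ x ∈ Icc (z₀ - (β - α)) (z₀ + (β - α)), ∀ y ∈ Icc (z₀ - (β - α)) (z₀ + (β - α)),
      |g x - g y| ≤ κ * |x - y|) {m : ℕ} (y : Fin m → Y) :
    radAvg (fun (i : ℕ × ℕ) j => g (ψ i.1 (y j) - c i.2)) ≤
      κ * (radAvg (fun k j => ψ k (y j)) + (β - α) / 2 * √m) := by
  have hmem : ∀ k y q, ψ k y - c q ∈ Icc (z₀ - (β - α)) (z₀ + (β - α)) := fun k y q =>
    sub_mem_Icc (hψb k y) (c q).2
  set U := max |z₀ - (β - α)| |z₀ + (β - α)|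
  have hU : ∀ k y q, |ψ k y - c q| ≤ U := fun k y q =>
    abs_le_max_abs_abs (hmem k y q).1 (hmem k y q).2
  have hgU : ∀ k y q, |g (ψ k y - c q)| ≤ κ * (U + |z₀|) + |g z₀| := by
    intro k y q
    have hz : z₀ ∈ Icc (z₀ - (β - α)) (z₀ + (β - α)) := by
      constructor <;> linarith [(hmem k y q).1, (hmem k y q).2]
    have h1 := (hg _ (hmem k y q) z₀ hz).trans (mul_le_mul_of_nonneg_left
      ((abs_sub _ _).trans (add_le_add_left (hU k y q) _)) hκ)
    have h2 : |g (ψ k y - c q)| ≤ |g (ψ k y - c q) - g z₀| + |g z₀| := by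
      simpa using abs_add_le (g (ψ k y - c q) - g z₀) (g z₀)
    linarith
  have hc := radAvg_le_of_contraction (S := fun (i : ℕ × ℕ) j => g (ψ i.1 (y j) - c i.2))
    (T := fun (i : ℕ × ℕ) j => κ * (ψ i.1 (y j) - c i.2)) (C := κ * (U + |z₀|) + |g z₀|)
    (fun i j => hgU _ _ _) (fun i j => ?_) fun i i' j => ?_
  · rw [radAvg_const_mul hκ] at hc
    exact hc.trans (mul_le_mul_of_nonneg_left (radAvg_sub_le hψb c y) hκ)
  · rw [abs_mul, abs_of_nonneg hκ]
    have := mul_le_mul_of_nonneg_left (hU i.1 (y j) i.2) hκ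
    have := mul_nonneg hκ (abs_nonneg z₀)
    linarith [abs_nonneg (g z₀)]
  · rw [← mul_sub, abs_mul, abs_of_nonneg hκ]
    exact hg _ (hmem _ _ _) _ (hmem _ _ _)

variable {f : ℝ → ℝ} {a : ℝ} {b : EReal}

/-- Both expected one-sided deviations between the values of `lam` at a measure and at its
empirical measures are at most twice the constant of `Kchoice`. -/
lemma integral_lamDev_le_of_Kchoice (ha0 : 0 ≤ a) (ha1 : a < 1) (hb1 : ((1 : ℝ) : EReal) < b)
    (hf1 : f 1 = 0) (hconv : ConvexOn ℝ (Dom a b) f)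
    (hstrict : ∃ ε > 0, Set.Ioo (1 - ε) (1 + ε) ⊆ Dom a b ∧
      StrictConvexOn ℝ (Set.Ioo (1 - ε) (1 + ε)) f)
    (hαβ : 0 < β - α) (hz : zz f + (β - α) ∈ interior {z : ℝ | fStar f a b z < ⊤})
    {Ψ : Set (Y → ℝ)} {ψ : ℕ → Y → ℝ} (hd : SeqDense ψ Ψ) (hm : ∀ g ∈ Ψ, Measurable g)
    (hb : ∀ g ∈ Ψ, ∀ y, g y ∈ Icc α β) {P : Measure Y} [IsProbabilityMeasure P] {m : ℕ}
    (hm0 : 0 < m) {s : ℝ} (hs : |s| = 1) {K : ℝ} (hK : Kchoice f a b α β Ψ P m K) :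
    ∫ y, lamDev (fStarR f a b) α β (zz f) P ψ s m y ∂(Measure.pi fun _ : Fin m => P) ≤
      2 * K := by
  have hF := isLegendre_fStarR ha0 ha1 hb1 hf1 hconv hαβ hz
  set F := fStarR f a b
  set L := rderiv F (zz f + (β - α))
  have hψ : ∀ k, Measurable (ψ k) := fun k => hm _ (hd.1 k)
  have hψb : ∀ k y, ψ k y ∈ Icc α β := fun k => hb _ (hd.1 k)
  have hψC : ∀ k y, |ψ k y| ≤ max |α| |β| := fun k y =>
    abs_le_max_abs_abs (hψb k y).1 (hψb k y).2
  have := hF.Icc_nonempty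
  have hc := TopologicalSpace.denseRange_denseSeq (Icc (α - zz f) (β - zz f))
  set c := TopologicalSpace.denseSeq (Icc (α - zz f) (β - zz f))
  have hR := hd.rad_eq (C := max |α| |β|)
    (fun g hg y => abs_le_max_abs_abs (hb g hg y).1 (hb g hg y).2) P m
  have hR0 : 0 ≤ rad Ψ P m := by
    rw [hR]
    exact mul_nonneg (by positivity) (integral_nonneg fun y => radAvg_nonneg fun k j => hψC k _)
  have hm' : (0 : ℝ) < √m := Real.sqrt_pos.2 (by exact_mod_cast hm0)
  have bound1 : ∫ y, lamDev F α β (zz f) P ψ s m y ∂(Measure.pi fun _ : Fin m => P) ≤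
      2 * (L * (rad Ψ P m + (β - α) / (2 * √m))) := by
    refine (hF.integral_lamDev_le hψ hψb hm0 hs hc (r := fun _ => 0) (B := 0) (by simp)
      (A := L) (D := L * ((β - α) / 2)) fun y => ?_).trans (le_of_eq ?_)
    · simp only [add_zero]
      exact (radAvg_comp_sub_le hψb c hF.nonneg hF.lip y).trans (le_of_eq (by ring))
    · rw [← hR]
      field_simp
  rcases hK with ⟨M, hM, -, rfl⟩ | rfl
  · rw [mul_min_of_nonneg _ _ (by norm_num)]
    refine le_min ?_ (by rwa [add_comm (β - α)])
    have hg := abs_fStarR_sub_id_le ha0 ha1 hb1 hf1 hconv hαβ hz hstrict hM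
    have hg' : ∀ (i : ℕ × ℕ) y, |F (ψ i.1 y - c i.2) - (ψ i.1 y - c i.2)| ≤
        |zz f| + L * (β - α) + (max |α| |β| + max |α - zz f| |β - zz f|) := fun i y =>
      (abs_sub _ _).trans (add_le_add (hF.abs_comp_sub_le hψb _ _ (c i.2).2) ((abs_sub _ _).trans
        (add_le_add (hψC _ _) (abs_le_max_abs_abs (c i.2).2.1 (c i.2).2.2))))
    have hMw : 0 ≤ (M : ℝ) * (β - α) := mul_nonneg M.2 hαβ.le
    refine (hF.integral_lamDev_le hψ hψb hm0 hs hc (r := fun q => c q)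
      (B := max |α - zz f| |β - zz f|) (fun q => abs_le_max_abs_abs (c q).2.1 (c q).2.2)
      (A := 1 + M * (β - α)) (D := M * (β - α) * ((β - α) / 2)) fun y => ?_).trans ?_
    · have h1 : radAvg (fun (i : ℕ × ℕ) j => F (ψ i.1 (y j) - c i.2) + c i.2) ≤
          radAvg (fun k j => ψ k (y j)) +
          radAvg (fun (i : ℕ × ℕ) j => F (ψ i.1 (y j) - c i.2) - (ψ i.1 (y j) - c i.2)) := by
        refine radAvg_le_add (fun k j => hψC k (y j)) (fun i j => hg' i (y j)) Prod.fst id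
          fun i j => ?_
        simp
        ring
      have h2 := radAvg_comp_sub_le hψb c hMw hg y
      linarith
    · rw [← hR]
      have h4 : M * (β - α) * ((β - α) / 2) / √m = (β - α) ^ 2 * M / (2 * √m) := by
        field_simp
      rw [h4]
      have := mul_nonneg hMw hR0
      linarith
  · rwa [add_comm (β - α)]

end Expectation

section MeanDeviation

variable {Y : Type*} [MeasurableSpace Y] {φ : ℕ → Y → ℝ} {α β : ℝ} {n : ℕ}

/-- The largest deviation between the expectation under `P` and the empirical mean along `φ`. -/
noncomputable def meanDev (P : Measure Y) (φ : ℕ → Y → ℝ) (n : ℕ) (x : Fin n → Y) : ℝ :=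
  ⨆ k, ((∫ y, φ k y ∂P) - (n : ℝ)⁻¹ * ∑ j, φ k (x j))

lemma measurable_meanDev {P : Measure Y} (hφ : ∀ k, Measurable (φ k)) :
    Measurable fun x : Fin n → Y => meanDev P φ n x :=
  .iSup fun k => measurable_const.sub
    ((Finset.measurable_sum _ fun j _ => (hφ k).comp (measurable_pi_apply j)).const_mul _)

variable {P : Measure Y} [IsProbabilityMeasure P]

lemma abs_meanDev_le (hn : 0 < n) {C : ℝ} (hC : ∀ k y, |φ k y| ≤ C) (x : Fin n → Y) :
    |meanDev P φ n x| ≤ C + C :=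
  abs_iSup_le fun k => abs_integral_sub_le hn (hC k) x

lemma le_meanDev (hn : 0 < n) {C : ℝ} (hC : ∀ k y, |φ k y| ≤ C) (k : ℕ) (x : Fin n → Y) :
    (∫ y, φ k y ∂P) - (n : ℝ)⁻¹ * ∑ j, φ k (x j) ≤ meanDev P φ n x :=
  le_ciSup (f := fun k => (∫ y, φ k y ∂P) - (n : ℝ)⁻¹ * ∑ j, φ k (x j))
    ⟨C + C, by
      rintro _ ⟨k, rfl⟩
      exact (le_abs_self _).trans (abs_integral_sub_le hn (hC k) x)⟩ k

lemma meanDev_update_le (hn : 0 < n) (hφb : ∀ k y, φ k y ∈ Icc α β) (x : Fin n → Y) (j : Fin n)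
    (v : Y) :
    meanDev P φ n (Function.update x j v) ≤ meanDev P φ n x + (β - α) / n := by
  have hn' : (0 : ℝ) < n := by exact_mod_cast hn
  refine ciSup_le fun k => ?_
  have h1 := le_meanDev (P := P) hn
    (fun k y => abs_le_max_abs_abs (hφb k y).1 (hφb k y).2) k x
  have h2 : ∑ i, φ k (x i) ≤ ∑ i, φ k (Function.update x j v i) + (β - α) := by
    rw [← Finset.sum_erase_add _ _ (Finset.mem_univ j),
      ← Finset.sum_erase_add _ (fun i => φ k (Function.update x j v i)) (Finset.mem_univ j),
      Function.update_self]
    have : ∑ i ∈ Finset.univ.erase j, φ k (Function.update x j v i) =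
        ∑ i ∈ Finset.univ.erase j, φ k (x i) :=
      Finset.sum_congr rfl fun i hi => by rw [Function.update_of_ne (Finset.ne_of_mem_erase hi)]
    linarith [(hφb k (x j)).2, (hφb k v).1]
  have h3 := mul_le_mul_of_nonneg_left h2 (inv_nonneg.2 hn'.le)
  rw [mul_add] at h3
  rw [div_eq_inv_mul]
  linarith

lemma integral_meanDev_le {Ψ : Set (Y → ℝ)} (hd : SeqDense φ Ψ) (hm : ∀ g ∈ Ψ, Measurable g)
    {C : ℝ} (hb : ∀ g ∈ Ψ, ∀ y, |g y| ≤ C) (hn : 0 < n) :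
    ∫ x, meanDev P φ n x ∂(Measure.pi fun _ : Fin n => P) ≤ 2 * rad Ψ P n := by
  rw [hd.rad_eq hb]
  exact integral_iSup_sub_le P hn (fun k => hm _ (hd.1 k)) fun k => hb _ (hd.1 k)

lemma SeqDense.integral_sub_le_meanDev {Ψ : Set (Y → ℝ)} (hd : SeqDense φ Ψ)
    (hm : ∀ g ∈ Ψ, Measurable g) {C : ℝ} (hb : ∀ g ∈ Ψ, ∀ y, |g y| ≤ C) (hn : 0 < n)
    {g : Y → ℝ} (hg : g ∈ Ψ) (x : Fin n → Y) :
    (∫ y, g y ∂P) - ∫ y, g y ∂(empMeas n x) ≤ meanDev P φ n x := by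
  rw [integral_empMeas x (hm g hg)]
  refine hd.le_of_forall_le (W := fun g => (∫ y, g y ∂P) - (n : ℝ)⁻¹ * ∑ j, g (x j))
    (fun s g hs _ hlim => ?_) (fun k => le_meanDev hn (fun k => hb _ (hd.1 k)) k x) hg
  refine Tendsto.sub ?_ ((tendsto_finsetSum _ fun i _ => hlim (x i)).const_mul _)
  exact tendsto_integral_of_dominated_convergence (fun _ => C)
    (fun j => (hm _ (hs j)).aestronglyMeasurable) (integrable_const _)
    (fun j => ae_of_all _ fun y => hb _ (hs j) y) (ae_of_all _ hlim)

lemma SeqDense.mul_lam_sub_le_lamDev {F : ℝ → ℝ} {z₀ L : ℝ} (hF : IsLegendre F z₀ (β - α) L)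
    {Ψ : Set (Y → ℝ)} (hd : SeqDense φ Ψ) (hm : ∀ g ∈ Ψ, Measurable g)
    (hb : ∀ g ∈ Ψ, ∀ y, g y ∈ Icc α β) (hn : 0 < n) {s : ℝ} (hs : |s| = 1)
    {g : Y → ℝ} (hg : g ∈ Ψ) (y : Fin n → Y) :
    s * (lam F α β z₀ P g - lam F α β z₀ (empMeas n y) g) ≤ lamDev F α β z₀ P φ s n y := by
  have := isProbabilityMeasure_empMeas hn y
  refine hd.le_of_forall_le
    (W := fun g => s * (lam F α β z₀ P g - lam F α β z₀ (empMeas n y) g))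
    (fun u g hu hg hlim => ?_)
    (fun k => hF.le_lamDev (fun k => hm _ (hd.1 k)) (fun k => hb _ (hd.1 k)) hn hs k y) hg
  have h (R : Measure Y) [IsProbabilityMeasure R] :=
    hF.tendsto_lam (P := R) (hm _ hg) (hb _ hg) (fun j => hm _ (hu j)) (fun j => hb _ (hu j)) hlim
  exact ((h P).sub (h (empMeas n y))).const_mul s

end MeanDeviation

section Divergence

variable {X : Type*} [MeasurableSpace X] {f : ℝ → ℝ} {a : ℝ} {b : EReal} {α β L : ℝ}
  (hF : IsLegendre (fStarR f a b) (zz f) (β - α) L) {Γ Γt : Set (X → ℝ)}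
  (hcgf : ∀ h ∈ Γ, ∀ P : Measure X, IsProbabilityMeasure P →
    cgfR f a b P h = lam (fStarR f a b) α β (zz f) P h)
  (hm : ∀ h ∈ Γ, Measurable h) (hb : ∀ h ∈ Γ, ∀ x, h x ∈ Icc α β)
  {Q P : Measure X} [IsProbabilityMeasure Q] [IsProbabilityMeasure P]
include hF hcgf hm hb

omit hcgf in
lemma integral_sub_lam_mem_Icc {h : X → ℝ} (hh : h ∈ Γ) :
    (∫ x, h x ∂Q) - lam (fStarR f a b) α β (zz f) P h ∈ Icc (α - β) (β - α) := by
  have h1 := hF.lam_mem_Icc (P := P) (hm h hh) (hb h hh)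
  have hi := integrable_of_mem_Icc (P := Q) (hm h hh) (hb h hh)
  have h2 := integral_mono (integrable_const α) hi fun x => (hb h hh x).1
  have h3 := integral_mono hi (integrable_const β) fun x => (hb h hh x).2
  simp at h2 h3
  constructor <;> linarith [h1.1, h1.2]

lemma le_Dfg {h : X → ℝ} (hh : h ∈ Γ) :
    (∫ x, h x ∂Q) - lam (fStarR f a b) α β (zz f) P h ≤ Dfg f a b Γ Q P := by
  refine le_csSup ⟨β - α, ?_⟩ ⟨h, hh, by rw [hcgf h hh P ‹_›]⟩
  rintro _ ⟨h, hh, rfl⟩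
  rw [hcgf h hh P ‹_›]
  exact (integral_sub_lam_mem_Icc hF hm hb hh).2

omit hF hm hb [IsProbabilityMeasure Q] in
lemma Dfg_le (hne : Γ.Nonempty) {c : ℝ}
    (h : ∀ h ∈ Γ, (∫ x, h x ∂Q) - lam (fStarR f a b) α β (zz f) P h ≤ c) :
    Dfg f a b Γ Q P ≤ c := by
  obtain ⟨h₀, hh₀⟩ := hne
  refine csSup_le ⟨_, h₀, hh₀, rfl⟩ ?_
  rintro _ ⟨h', hh', rfl⟩
  rw [hcgf h' hh' P ‹_›]
  exact h h' hh'

lemma sub_le_Dfg (hne : Γ.Nonempty) : α - β ≤ Dfg f a b Γ Q P := by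
  obtain ⟨h, hh⟩ := hne
  exact (integral_sub_lam_mem_Icc hF hm hb hh).1.trans (le_Dfg hF hcgf hm hb hh)

omit [IsProbabilityMeasure Q] in
lemma Dfg_le_Dfg_add (hne : Γ.Nonempty) {Q' P' : Measure X} [IsProbabilityMeasure Q']
    [IsProbabilityMeasure P'] {c : ℝ}
    (h : ∀ h ∈ Γ, (∫ x, h x ∂Q) - lam (fStarR f a b) α β (zz f) P h ≤
      (∫ x, h x ∂Q') - lam (fStarR f a b) α β (zz f) P' h + c) :
    Dfg f a b Γ Q P ≤ Dfg f a b Γ Q' P' + c :=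
  Dfg_le hcgf hne fun g hg => (h g hg).trans
    (add_le_add_left (le_Dfg hF hcgf hm hb hg) c)

/-- Enlarging the discriminator space costs at most a multiple of the approximation error. -/
lemma Dfg_le_add_approxErr (hsub : Γt ⊆ Γ) (hne : Γt.Nonempty) :
    Dfg f a b Γ Q P ≤ Dfg f a b Γt Q P + (1 + L) * approxErr Γ Γt := by
  have hX : Nonempty X := nonempty_of_isProbabilityMeasure Q
  have hL : 0 < 1 + L := by linarith [hF.nonneg]
  have habs : ∀ h ∈ Γ, ∀ g ∈ Γ, ∀ x, |h x - g x| ≤ β - α := by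
    intro h hh g hg x
    rw [abs_le]
    constructor <;> linarith [(hb h hh x).1, (hb h hh x).2, (hb g hg x).1, (hb g hg x).2]
  have hbelow : ∀ h : X → ℝ, BddBelow {s : ℝ | ∃ ht ∈ Γt, s = ⨆ x, |h x - ht x|} := by
    refine fun h => ⟨0, ?_⟩
    rintro _ ⟨g, -, rfl⟩
    exact Real.iSup_nonneg fun x => abs_nonneg _
  have happrox : ∀ h ∈ Γ, sInf {s : ℝ | ∃ ht ∈ Γt, s = ⨆ x, |h x - ht x|} ≤ approxErr Γ Γt := by
    intro h hh
    refine le_csSup ⟨β - α, ?_⟩ ⟨h, hh, rfl⟩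
    rintro _ ⟨g, hg, rfl⟩
    obtain ⟨g', hg'⟩ := hne
    exact (csInf_le (hbelow g) ⟨g', hg', rfl⟩).trans (ciSup_le (habs g hg g' (hsub hg')))
  refine Dfg_le hcgf (hne.mono hsub) fun h hh => ?_
  rw [← sub_le_iff_le_add', ← div_le_iff₀' hL]
  refine le_trans (le_csInf ?_ ?_) (happrox h hh)
  · obtain ⟨g, hg⟩ := hne
    exact ⟨_, g, hg, rfl⟩
  · rintro _ ⟨g, hg, rfl⟩
    rw [div_le_iff₀' hL]
    set s := ⨆ x, |h x - g x|
    have hs : ∀ x, |h x - g x| ≤ s := fun x =>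
      le_ciSup (f := fun x => |h x - g x|)
        ⟨β - α, by rintro _ ⟨x, rfl⟩; exact habs h hh g (hsub hg) x⟩ x
    have hg' := hsub hg
    have ih (R : Measure X) [IsProbabilityMeasure R] :=
      integrable_of_mem_Icc (P := R) (hm h hh) (hb h hh)
    have ig (R : Measure X) [IsProbabilityMeasure R] :=
      integrable_of_mem_Icc (P := R) (hm g hg') (hb g hg')
    have h1 := le_Dfg (Γ := Γt) (Q := Q) (P := P) hF (fun h hh => hcgf h (hsub hh))
      (fun h hh => hm h (hsub hh)) (fun h hh => hb h (hsub hh)) hg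
    have h2 := hF.lam_le_lam_add (P := P) (hm g hg') (hb g hg') (hm h hh) (hb h hh)
    have h3 : ∫ x, |g x - h x| ∂P ≤ s := by
      have := integral_mono ((ig P).sub (ih P)).abs (integrable_const s) fun x => by
        have := hs x
        rw [abs_sub_comm] at this
        exact this
      simpa using this
    have h4 : ∫ x, h x ∂Q ≤ (∫ x, g x ∂Q) + s := by
      have := integral_mono (ih Q) ((ig Q).add (integrable_const s)) fun x => by
        have := (le_abs_self _).trans (hs x)
        change h x ≤ g x + s
        linarith
      rw [integral_add' (ig Q) (integrable_const s)] at this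
      simpa using this
    have h5 := mul_le_mul_of_nonneg_left h3 hF.nonneg
    linarith

end Divergence

section Concentration

variable {X Z Θ : Type*} [MeasurableSpace X] [MeasurableSpace Z] {f : ℝ → ℝ} {a : ℝ} {b : EReal}
  {α β L : ℝ}

/-- The largest one-coordinate oscillation of `lamDev` is at most `Δq / m`. -/
lemma lamDev_update_le_Δq (hF : IsLegendre (fStarR f a b) (zz f) (β - α) L) {ψ : ℕ → Z → ℝ}
    (hψ : ∀ k, Measurable (ψ k)) (hψb : ∀ k y, ψ k y ∈ Icc α β) {P : Measure Z}
    [IsProbabilityMeasure P] {m : ℕ} (hm : 0 < m) {s : ℝ} (hs : |s| = 1) (y : Fin m → Z)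
    (j : Fin m) (v : Z) :
    lamDev (fStarR f a b) α β (zz f) P ψ s m (Function.update y j v) ≤
      lamDev (fStarR f a b) α β (zz f) P ψ s m y + Δq f a b α β m / m := by
  have hm' : (0 : ℝ) < m := by exact_mod_cast hm
  rw [← sub_le_iff_le_add', le_div_iff₀' hm']
  refine le_csInf ((nonempty_Icc.2 (by linarith [hF.pos])).image _) ?_
  rintro _ ⟨z, hz, rfl⟩
  exact mul_le_mul_of_nonneg_left
    (sub_le_iff_le_add'.2 (hF.lamDev_update_le hψ hψb hm hs y j v hz)) m.cast_nonneg

/-- Deterministic bound for an approximate minimizer of the empirical divergence. -/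
lemma Dfg_map_le_of_approx_min [Nonempty Θ]
    (hF : IsLegendre (fStarR f a b) (zz f) (β - α) L) {Γ Γt : Set (X → ℝ)}
    (hcgf : ∀ h ∈ Γ, ∀ P : Measure X, IsProbabilityMeasure P →
      cgfR f a b P h = lam (fStarR f a b) α β (zz f) P h)
    (hmeas : ∀ h ∈ Γ, Measurable h) (hb : ∀ h ∈ Γ, ∀ x, h x ∈ Icc α β)
    (hsub : Γt ⊆ Γ) (hne : Γt.Nonempty) {Q : Measure X} [IsProbabilityMeasure Q] {PZ : Measure Z}
    [IsProbabilityMeasure PZ] {Φ : Θ → Z → X} (hΦ : ∀ θ, Measurable (Φ θ))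
    {ψ : ℕ → X → ℝ} (hψ : SeqDense ψ Γt) {φ : ℕ → Z → ℝ}
    (hφ : SeqDense φ {g : Z → ℝ | ∃ h ∈ Γt, ∃ θ : Θ, g = fun z => h (Φ θ z)})
    {n m : ℕ} (hn : 0 < n) (hm : 0 < m) {xs : Fin n → X} {zs : Fin m → Z}
    (hzero : (⨅ θ : Θ, Dfg f a b Γt (empMeas n xs) (Measure.map (Φ θ) PZ)) = 0)
    {θ : Θ} {εopt : ℝ}
    (hopt : Dfg f a b Γt (empMeas n xs) (Measure.map (Φ θ) (empMeas m zs)) ≤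
      (⨅ θ : Θ, Dfg f a b Γt (empMeas n xs) (Measure.map (Φ θ) (empMeas m zs))) + εopt) :
    Dfg f a b Γ Q (Measure.map (Φ θ) PZ) ≤ (1 + L) * approxErr Γ Γt + εopt +
      (meanDev Q ψ n xs + (lamDev (fStarR f a b) α β (zz f) PZ φ 1 m zs +
        lamDev (fStarR f a b) α β (zz f) PZ φ (-1) m zs)) := by
  have hcgf' : ∀ h ∈ Γt, ∀ P : Measure X, IsProbabilityMeasure P →
    cgfR f a b P h = lam (fStarR f a b) α β (zz f) P h := fun h hh => hcgf h (hsub hh)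
  have hmt : ∀ h ∈ Γt, Measurable h := fun h hh => hmeas h (hsub hh)
  have hbt : ∀ h ∈ Γt, ∀ x, h x ∈ Icc α β := fun h hh => hb h (hsub hh)
  have := isProbabilityMeasure_empMeas hn xs
  have := isProbabilityMeasure_empMeas hm zs
  have hP (θ : Θ) : IsProbabilityMeasure (Measure.map (Φ θ) PZ) :=
    Measure.isProbabilityMeasure_map (hΦ θ).aemeasurable
  have hP' (θ : Θ) : IsProbabilityMeasure (Measure.map (Φ θ) (empMeas m zs)) :=
    Measure.isProbabilityMeasure_map (hΦ θ).aemeasurable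
  have hlam {s : ℝ} (hs : |s| = 1) {h : X → ℝ} (hh : h ∈ Γt) (θ : Θ) :
      s * (lam (fStarR f a b) α β (zz f) (Measure.map (Φ θ) PZ) h -
        lam (fStarR f a b) α β (zz f) (Measure.map (Φ θ) (empMeas m zs)) h) ≤
      lamDev (fStarR f a b) α β (zz f) PZ φ s m zs := by
    rw [hF.lam_map (hmt h hh) (hΦ θ), hF.lam_map (hmt h hh) (hΦ θ)]
    refine hφ.mul_lam_sub_le_lamDev hF ?_ ?_ hm hs ⟨h, hh, θ, rfl⟩ zs
    · rintro _ ⟨h, hh, θ, rfl⟩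
      exact (hmt h hh).comp (hΦ θ)
    · rintro _ ⟨h, hh, θ, rfl⟩ z
      exact hbt h hh _
  have h1 := Dfg_le_add_approxErr (Q := Q) (P := Measure.map (Φ θ) PZ) hF hcgf hmeas hb hsub hne
  have h2 : Dfg f a b Γt Q (Measure.map (Φ θ) PZ) ≤
      Dfg f a b Γt (empMeas n xs) (Measure.map (Φ θ) PZ) + meanDev Q ψ n xs :=
    Dfg_le_Dfg_add hF hcgf' hmt hbt hne fun h hh => by
      have := hψ.integral_sub_le_meanDev (P := Q) hmt
        (fun g hg y => abs_le_max_abs_abs (hbt g hg y).1 (hbt g hg y).2) hn hh xs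
      linarith
  have h3 : Dfg f a b Γt (empMeas n xs) (Measure.map (Φ θ) PZ) ≤
      Dfg f a b Γt (empMeas n xs) (Measure.map (Φ θ) (empMeas m zs)) +
        lamDev (fStarR f a b) α β (zz f) PZ φ (-1) m zs :=
    Dfg_le_Dfg_add hF hcgf' hmt hbt hne fun h hh => by
      have := hlam (s := -1) (by simp) hh θ
      linarith
  have h4 : (⨅ θ : Θ, Dfg f a b Γt (empMeas n xs) (Measure.map (Φ θ) (empMeas m zs))) -
      lamDev (fStarR f a b) α β (zz f) PZ φ 1 m zs ≤ 0 := by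
    rw [← hzero]
    refine le_ciInf fun θ' => ?_
    have h5 : Dfg f a b Γt (empMeas n xs) (Measure.map (Φ θ') (empMeas m zs)) ≤
        Dfg f a b Γt (empMeas n xs) (Measure.map (Φ θ') PZ) +
          lamDev (fStarR f a b) α β (zz f) PZ φ 1 m zs :=
      Dfg_le_Dfg_add hF hcgf' hmt hbt hne fun h hh => by
        have := hlam (s := 1) (by simp) hh θ'
        linarith
    have h6 := ciInf_le (f := fun θ : Θ =>
      Dfg f a b Γt (empMeas n xs) (Measure.map (Φ θ) (empMeas m zs)))
      ⟨α - β, by rintro _ ⟨θ, rfl⟩; exact sub_le_Dfg hF hcgf' hmt hbt hne⟩ θ'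
    linarith
  linarith

end Concentration

open MeasureTheory in
/-- `(f,Γ)`-GAN concentration inequality under the zero generator
approximation error property. -/
theorem stmt12
    {X : Type*} [TopologicalSpace X] [MeasurableSpace X] [BorelSpace X]
    (f : ℝ → ℝ) (a : ℝ) (b : EReal) (α β : ℝ)
    (ha0 : 0 ≤ a) (ha1 : a < 1) (hb1 : ((1 : ℝ) : EReal) < b)
    (hconv : ConvexOn ℝ (Dom a b) f) (hf1 : f 1 = 0)
    (hstrict : ∃ ε > 0, Set.Ioo (1 - ε) (1 + ε) ⊆ Dom a b ∧
      StrictConvexOn ℝ (Set.Ioo (1 - ε) (1 + ε)) f)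
    (hz : zz f + β - α ∈ interior {z : ℝ | fStar f a b z < ⊤})
    (hαβ : α < β)
    (Γt Γ : Set (X → ℝ)) (hsub : Γt ⊆ Γ) (hΓtne : Γt.Nonempty)
    (hcont : ∀ h ∈ Γ, Continuous h) (hbd : ∀ h ∈ Γ, ∀ x, h x ∈ Set.Icc α β)
    (hΓd : PtwiseDenseCount Γ) (hΓtd : PtwiseDenseCount Γt)
    {Z : Type*} [MeasurableSpace Z] (PZ : Measure Z) [IsProbabilityMeasure PZ]
    {Θ : Type*} [MetricSpace Θ] [TopologicalSpace.SeparableSpace Θ] [Nonempty Θ]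
    [MeasurableSpace Θ] [BorelSpace Θ]
    (Φ : Θ → Z → X) (hΦm : ∀ θ, Measurable (Φ θ)) (hΦc : ∀ z, Continuous fun θ => Φ θ z)
    (Q : Measure X) [IsProbabilityMeasure Q]
    {Ω : Type*} [MeasurableSpace Ω] (ℙ : Measure Ω) [IsProbabilityMeasure ℙ]
    (n m : ℕ) (hn : 0 < n) (hm : 0 < m)
    (Xs : Fin n → Ω → X) (Zs : Fin m → Ω → Z)
    (hXm : ∀ i, Measurable (Xs i)) (hZm : ∀ j, Measurable (Zs j))
    (hlaw : Measure.map (fun ω => (fun i => Xs i ω, fun j => Zs j ω)) ℙ =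
      (Measure.pi fun _ : Fin n => Q).prod (Measure.pi fun _ : Fin m => PZ))
    (θstar : Ω → Θ) (hθm : Measurable θstar)
    (εopt : ℝ) (hεopt : 0 ≤ εopt)
    (hopt : ∀ᵐ ω ∂ℙ,
      Dfg f a b Γt (empMeas n fun i => Xs i ω)
          (Measure.map (Φ (θstar ω)) (empMeas m fun j => Zs j ω)) ≤
        (⨅ θ : Θ, Dfg f a b Γt (empMeas n fun i => Xs i ω)
          (Measure.map (Φ θ) (empMeas m fun j => Zs j ω))) + εopt)
    (hzero : ∀ xs : Fin n → X,
      (⨅ θ : Θ, Dfg f a b Γt (empMeas n xs) (Measure.map (Φ θ) PZ)) = 0)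
    (K : ℝ)
    (hK : Kchoice f a b α β {g : Z → ℝ | ∃ h ∈ Γt, ∃ θ : Θ, g = fun z => h (Φ θ z)} PZ m K)
    (ε : ℝ) (hε : 0 < ε) :
    (ℙ {ω | Dfg f a b Γ Q (Measure.map (Φ (θstar ω)) PZ) ≥
        ε + (1 + rderiv (fStarR f a b) (zz f + β - α)) * approxErr Γ Γt
          + εopt + 2 * rad Γt Q n + 4 * K}).toReal ≤
      Real.exp (-(ε ^ 2) /
        ((1 / (2 * (n : ℝ))) * (β - α) ^ 2 + (2 / (m : ℝ)) * (Δq f a b α β m) ^ 2)) := by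
  have hw : 0 < β - α := sub_pos.2 hαβ
  have hz' : zz f + (β - α) ∈ interior {z : ℝ | fStar f a b z < ⊤} := by
    rwa [← add_sub_assoc]
  have hF := isLegendre_fStarR ha0 ha1 hb1 hf1 hconv hw hz'
  have hmeas : ∀ h ∈ Γ, Measurable h := fun h hh => (hcont h hh).measurable
  have hcgf : ∀ h ∈ Γ, ∀ P : Measure X, IsProbabilityMeasure P →
      cgfR f a b P h = lam (fStarR f a b) α β (zz f) P h := fun h hh P _ =>
    cgfR_eq_lam ha1 hb1 hf1 (fun z h => fStar_lt_top ha0 hz' h) hF (hmeas h hh) (hbd h hh)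
  obtain ⟨ψ, hψ⟩ := hΓtd.exists_seqDense hΓtne
  obtain ⟨φ, hφ⟩ := hψ.exists_comp (fun h hh => hcont h (hsub hh)) hΦc
  have hΨm : ∀ g ∈ {g : Z → ℝ | ∃ h ∈ Γt, ∃ θ : Θ, g = fun z => h (Φ θ z)}, Measurable g := by
    rintro _ ⟨h, hh, θ, rfl⟩
    exact (hmeas h (hsub hh)).comp (hΦm θ)
  have hΨb : ∀ g ∈ {g : Z → ℝ | ∃ h ∈ Γt, ∃ θ : Θ, g = fun z => h (Φ θ z)},
      ∀ z, g z ∈ Icc α β := by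
    rintro _ ⟨h, hh, θ, rfl⟩ z
    exact hbd h (hsub hh) _
  have hΓtb : ∀ h ∈ Γt, ∀ x, |h x| ≤ max |α| |β| := fun h hh x =>
    abs_le_max_abs_abs (hbd h (hsub hh) x).1 (hbd h (hsub hh) x).2
  have hψm : ∀ k, Measurable (ψ k) := fun k => hmeas _ (hsub (hψ.1 k))
  have hφm : ∀ k, Measurable (φ k) := fun k => hΨm _ (hφ.1 k)
  have hφb : ∀ k z, φ k z ∈ Icc α β := fun k => hΨb _ (hφ.1 k)
  set G : (Fin n → X) → ℝ := meanDev Q ψ n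
  set H : ℝ → (Fin m → Z) → ℝ := fun s => lamDev (fStarR f a b) α β (zz f) PZ φ s m
  have hHm : ∀ s, Measurable (H s) := fun s => hF.measurable_lamDev hφm hφb hm
  have hHb {s : ℝ} (hs : |s| = 1) : ∀ z, |H s z| ≤ β - α :=
    hF.abs_lamDev_le hφm hφb hm hs
  have hHu {s : ℝ} (hs : |s| = 1) := fun zs j v =>
    lamDev_update_le_Δq (P := PZ) hF hφm hφb hm hs zs j v
  have hGm : Measurable G := measurable_meanDev hψm
  have hI {s : ℝ} (hs : |s| = 1) :
      ∫ z, H s z ∂(Measure.pi fun _ : Fin m => PZ) ≤ 2 * K :=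
    integral_lamDev_le_of_Kchoice ha0 ha1 hb1 hf1 hconv hstrict hw hz' hφ hΨm hΨb hm hs hK
  have hIG : ∫ x, G x ∂(Measure.pi fun _ : Fin n => Q) ≤ 2 * rad Γt Q n :=
    integral_meanDev_le hψ (fun h hh => hmeas h (hsub hh)) hΓtb hn
  have h1 : |(1 : ℝ)| = 1 := by simp
  have h2 : |(-1 : ℝ)| = 1 := by simp
  have hIH : ∫ z, (H 1 z + H (-1) z) ∂(Measure.pi fun _ : Fin m => PZ) ≤ 4 * K := by
    rw [integral_add (integrable_of_abs_le (hHm 1) (hHb h1))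
      (integrable_of_abs_le (hHm (-1)) (hHb h2))]
    linarith [hI h1, hI h2]
  have hT : Measurable fun ω => (fun i => Xs i ω, fun j => Zs j ω) :=
    (measurable_pi_lambda _ hXm).prodMk (measurable_pi_lambda _ hZm)
  have htail := measureReal_ge_le_of_update_le (P := Q) (P' := PZ) hGm
    ((hHm 1).add (hHm (-1))) (abs_meanDev_le hn fun k => hΓtb _ (hψ.1 k))
    (D := (β - α) + (β - α))
    (fun z => (abs_add_le _ _).trans (add_le_add (hHb h1 z) (hHb h2 z)))
    (c := (β - α) / n) (d := 2 * (Δq f a b α β m / m))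
    (meanDev_update_le hn fun k => hbd _ (hsub (hψ.1 k)))
    (fun zs j v => by
      have := hHu h1 zs j v
      have := hHu h2 zs j v
      simp only [Pi.add_apply, H]
      linarith) hε.le
  simp only [Pi.add_apply] at htail
  have hn' : (n : ℝ) ≠ 0 := by exact_mod_cast hn.ne'
  have hm' : (m : ℝ) ≠ 0 := by exact_mod_cast hm.ne'
  have hexp : 2 * ((n * ((β - α) / n) ^ 2 + m * (2 * (Δq f a b α β m / m)) ^ 2) / 4) =
      (1 / (2 * (n : ℝ))) * (β - α) ^ 2 + (2 / (m : ℝ)) * (Δq f a b α β m) ^ 2 := by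
    field_simp
    ring
  have hGH : Measurable fun p : (Fin n → X) × (Fin m → Z) => G p.1 + (H 1 p.2 + H (-1) p.2) :=
    (hGm.comp measurable_fst).add
      (((hHm 1).comp measurable_snd).add ((hHm (-1)).comp measurable_snd))
  rw [hexp, ← hlaw, map_measureReal_apply hT (measurableSet_le measurable_const hGH)] at htail
  refine le_trans (ENNReal.toReal_mono (measure_ne_top _ _) (measure_mono_ae ?_)) htail
  filter_upwards [hopt] with ω hω hev
  have hdet := Dfg_map_le_of_approx_min (Q := Q) hF hcgf hmeas hbd hsub hΓtne hΦm hψ hφ hn hm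
    (hzero fun i => Xs i ω) hω
  have hev' := ge_iff_le.1 (show _ ≥ _ from hev)
  rw [add_sub_assoc] at hev'
  change (_ : ℝ) ≤ G _ + (H 1 _ + H (-1) _)
  simp only [G, H] at hIG hIH ⊢
  linarith
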